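/- arXiv:1703.06149 — 11 statements merged into one kernel-verified Lean document; each statement's English description precedes it below -/
import Mathlib

section
/- Let V_ABC be a real positive definite matrix on ℝ^{n_A+n_B+n_C} with 3×3 block structure over components A, B, C. Then the log-det conditional mutual information satisfies I_M(A:B|C)_V = I_M(A:B)_{V_ABC/V_C}, where V_ABC/V_C is the Schur complement of V_ABC with respect to the block V_C (itself a positive definite matrix with blocks indexed by A and B). -/
open Matrix

/-- Embedding of the `AC` indices into the `ABC` indices. -/
def eAC {α β γ : Type*} : α ⊕ γ → α ⊕ (β ⊕ γ) := Sum.map id Sum.inr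

/-- Embedding of the `BC` indices into the `ABC` indices. -/
def eBC {α β γ : Type*} : β ⊕ γ → α ⊕ (β ⊕ γ) := Sum.inr

/-- Embedding of the `C` indices into the `ABC` indices. -/
def eC {α β γ : Type*} : γ → α ⊕ (β ⊕ γ) := fun k => Sum.inr (Sum.inr k)

/-- Embedding of the `AB` indices into the `ABC` indices. -/
def eAB {α β γ : Type*} : α ⊕ β → α ⊕ (β ⊕ γ) := Sum.map id Sum.inl

/-- Log-det mutual information of a bipartite positive definite matrix. -/
noncomputable def IM2 {α β : Type*} [Fintype α] [Fintype β] [DecidableEq α] [DecidableEq β]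
    (V : Matrix (α ⊕ β) (α ⊕ β) ℝ) : ℝ :=
  (1 / 2) * Real.log ((V.toBlocks₁₁.det * V.toBlocks₂₂.det) / V.det)

/-- Log-det conditional mutual information of a tripartite positive definite matrix. -/
noncomputable def IM3 {α β γ : Type*} [Fintype α] [Fintype β] [Fintype γ]
    [DecidableEq α] [DecidableEq β] [DecidableEq γ]
    (V : Matrix (α ⊕ (β ⊕ γ)) (α ⊕ (β ⊕ γ)) ℝ) : ℝ :=
  (1 / 2) * Real.log
    (((V.submatrix eAC eAC).det * (V.submatrix eBC eBC).det) /
      ((V.submatrix eC eC).det * V.det))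

/-- Schur complement of a tripartite matrix with respect to its `C` block,
as a bipartite matrix over the `AB` indices. -/
noncomputable def schurC {α β γ : Type*} [Fintype α] [Fintype β] [Fintype γ]
    [DecidableEq α] [DecidableEq β] [DecidableEq γ]
    (V : Matrix (α ⊕ (β ⊕ γ)) (α ⊕ (β ⊕ γ)) ℝ) : Matrix (α ⊕ β) (α ⊕ β) ℝ :=
  V.submatrix eAB eAB - V.submatrix eAB eC * (V.submatrix eC eC)⁻¹ * V.submatrix eC eAB

/-- The Schur determinant formula for the submatrix on two families of indices. -/
theorem det_submatrix_sumElim {ι κ μ : Type*} [Fintype κ] [Fintype μ]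
    [DecidableEq κ] [DecidableEq μ] (V : Matrix ι ι ℝ) (e : κ → ι) (f : μ → ι)
    (hf : (V.submatrix f f).det ≠ 0) :
    (V.submatrix (Sum.elim e f) (Sum.elim e f)).det = (V.submatrix f f).det *
      (V.submatrix e e - V.submatrix e f * (V.submatrix f f)⁻¹ * V.submatrix f e).det := by
  let := Matrix.invertibleOfIsUnitDet _ (isUnit_iff_ne_zero.mpr hf)
  rw [← Matrix.invOf_eq_nonsing_inv, ← Matrix.det_fromBlocks₂₂]
  congr 1
  ext (i | i) (j | j) <;> rfl

/-- `I_M(A:B|C)_V = I_M(A:B)_{V_ABC/V_C}`. -/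
theorem stmt0 {nA nB nC : ℕ}
    (V : Matrix (Fin nA ⊕ (Fin nB ⊕ Fin nC)) (Fin nA ⊕ (Fin nB ⊕ Fin nC)) ℝ)
    (hV : V.PosDef) :
    IM3 V = IM2 (schurC V) := by
  have hC : (V.submatrix eC eC).det ≠ 0 :=
    (hV.submatrix (e := eC) fun i j h => Sum.inr_injective (Sum.inr_injective h)).det_pos.ne'
  have hAC : (V.submatrix eAC eAC).det =
      (V.submatrix eC eC).det * (schurC V).toBlocks₁₁.det := by
    rw [show (eAC : Fin nA ⊕ Fin nC → Fin nA ⊕ (Fin nB ⊕ Fin nC)) = Sum.elim Sum.inl eC by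
      ext (i | i) <;> rfl, det_submatrix_sumElim V _ _ hC]
    rfl
  have hBC : (V.submatrix eBC eBC).det =
      (V.submatrix eC eC).det * (schurC V).toBlocks₂₂.det := by
    rw [show (eBC : Fin nB ⊕ Fin nC → Fin nA ⊕ (Fin nB ⊕ Fin nC)) =
      Sum.elim (Sum.inr ∘ Sum.inl) eC by ext (i | i) <;> rfl, det_submatrix_sumElim V _ _ hC]
    rfl
  have hABC : V.det = (V.submatrix eC eC).det * (schurC V).det := by
    rw [schurC, ← det_submatrix_sumElim V eAB eC hC,
      ← Matrix.det_submatrix_equiv_self (Equiv.sumAssoc (Fin nA) (Fin nB) (Fin nC)) V]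
    rfl
  rw [IM3, IM2, hAC, hBC, hABC]
  congr 2
  rw [mul_mul_mul_comm, ← mul_assoc (V.submatrix eC eC).det _ (schurC V).det,
    mul_div_mul_left _ _ (mul_ne_zero hC hC)]
end

section
/- Let V_ABC be a real positive definite matrix on ℝ^{n_A+n_B+n_C} with 3×3 block structure over components A, B, C. Then I_M(A:B|C)_V = (1/2)·ln( det (V⁻¹)_A · det (V⁻¹)_B / det (V⁻¹)_{AB} ), where (V⁻¹)_A, (V⁻¹)_B and (V⁻¹)_{AB} denote the principal submatrices of the inverse matrix V_ABC⁻¹ on the A components, the B components, and the union of the A and B components, respectively. -/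
open Matrix

/-- Embedding of the `A` indices into the `ABC` indices. -/
def eA {α β γ : Type*} : α → α ⊕ (β ⊕ γ) := Sum.inl

/-- Embedding of the `B` indices into the `ABC` indices. -/
def eB {α β γ : Type*} : β → α ⊕ (β ⊕ γ) := fun j => Sum.inr (Sum.inl j)

namespace Matrix

/-- **Jacobi's complementary minor formula** for the leading block of the inverse. -/
theorem det_mul_det_inv_toBlocks₁₁ {m n R : Type*} [Fintype m] [Fintype n] [DecidableEq m]
    [DecidableEq n] [CommRing R] (M : Matrix (m ⊕ n) (m ⊕ n) R) (hM : IsUnit M.det) :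
    M.det * M⁻¹.toBlocks₁₁.det = M.toBlocks₂₂.det := by
  have h : fromBlocks M.toBlocks₁₁ M.toBlocks₁₂ M.toBlocks₂₁ M.toBlocks₂₂ *
      fromBlocks M⁻¹.toBlocks₁₁ M⁻¹.toBlocks₁₂ M⁻¹.toBlocks₂₁ M⁻¹.toBlocks₂₂ =
      fromBlocks 1 0 0 1 := by
    simp only [fromBlocks_toBlocks, fromBlocks_one, mul_nonsing_inv M hM]
  rw [fromBlocks_multiply, fromBlocks_inj] at h
  have key : M * fromBlocks M⁻¹.toBlocks₁₁ 0 M⁻¹.toBlocks₂₁ 1 =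
      fromBlocks 1 M.toBlocks₁₂ 0 M.toBlocks₂₂ := by
    conv_lhs => rw [← fromBlocks_toBlocks M]
    rw [fromBlocks_multiply]
    simp only [fromBlocks_toBlocks, h.1, h.2.2.1, Matrix.mul_zero, Matrix.mul_one, zero_add]
  simpa using congrArg det key

/-- **Jacobi's complementary minor formula** for principal submatrices. -/
theorem det_mul_det_inv_submatrix {l m n R : Type*} [Fintype l] [Fintype m] [Fintype n]
    [DecidableEq l] [DecidableEq m] [DecidableEq n] [CommRing R] (M : Matrix l l R)
    (hM : IsUnit M.det) (e : m ⊕ n ≃ l) :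
    M.det * (M⁻¹.submatrix (e ∘ Sum.inl) (e ∘ Sum.inl)).det =
      (M.submatrix (e ∘ Sum.inr) (e ∘ Sum.inr)).det := by
  have h := det_mul_det_inv_toBlocks₁₁ (M.submatrix e e) (by rwa [det_submatrix_equiv_self])
  rwa [det_submatrix_equiv_self, inv_submatrix_equiv] at h

end Matrix

/-- `I_M(A:B|C)_V = (1/2)·ln( det (V⁻¹)_A · det (V⁻¹)_B / det (V⁻¹)_{AB} )`. -/
theorem stmt1 {nA nB nC : ℕ}
    (V : Matrix (Fin nA ⊕ (Fin nB ⊕ Fin nC)) (Fin nA ⊕ (Fin nB ⊕ Fin nC)) ℝ)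
    (hV : V.PosDef) :
    IM3 V = (1 / 2) * Real.log
      (((V⁻¹.submatrix eA eA).det * (V⁻¹.submatrix eB eB).det) /
        (V⁻¹.submatrix eAB eAB).det) := by
  have hu : IsUnit V.det := hV.det_pos.ne'.isUnit
  have hA : V.det * (V⁻¹.submatrix eA eA).det = (V.submatrix eBC eBC).det :=
    det_mul_det_inv_submatrix V hu (Equiv.refl _)
  have hB : V.det * (V⁻¹.submatrix eB eB).det = (V.submatrix eAC eAC).det := by
    let e : Fin nB ⊕ (Fin nA ⊕ Fin nC) ≃ Fin nA ⊕ (Fin nB ⊕ Fin nC) :=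
      (Equiv.sumAssoc _ _ _).symm.trans
        (((Equiv.sumComm _ _).sumCongr (Equiv.refl _)).trans (Equiv.sumAssoc _ _ _))
    have he : e ∘ Sum.inr = eAC := by
      funext x
      rcases x with x | x <;> rfl
    rw [← he]
    exact det_mul_det_inv_submatrix V hu e
  have hAB : V.det * (V⁻¹.submatrix eAB eAB).det = (V.submatrix eC eC).det := by
    have he : Equiv.sumAssoc (Fin nA) (Fin nB) (Fin nC) ∘ Sum.inl = eAB := by
      funext x
      rcases x with x | x <;> rfl
    rw [← he]
    exact det_mul_det_inv_submatrix V hu (Equiv.sumAssoc _ _ _)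
  have hV0 : V.det ≠ 0 := hV.det_pos.ne'
  rw [IM3, ← hA, ← hB, ← hAB, mul_right_comm V.det _ V.det, mul_mul_mul_comm,
    mul_div_mul_left _ _ (mul_ne_zero hV0 hV0), mul_comm (V⁻¹.submatrix eB eB).det]
end

section
/- Let V_AB and W_AB be real positive definite matrices on ℝ^{n_A+n_B} with the same 2×2 block structure over components A and B, and let t ∈ [0,1]. Then the log-det mutual information is convex along the weighted geometric mean: I_M(A:B)_{V #_t W} ≤ (1−t)·I_M(A:B)_V + t·I_M(A:B)_W. -/
open Matrix

/-- The `t`-th power of a positive definite (more generally, Hermitian) real matrix,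
defined through the spectral decomposition; junk value on non-Hermitian matrices. -/
noncomputable def mpow {N : Type*} [Fintype N] [DecidableEq N]
    (M : Matrix N N ℝ) (t : ℝ) : Matrix N N ℝ :=
  if hM : M.IsHermitian then
    (hM.eigenvectorUnitary : Matrix N N ℝ) *
      Matrix.diagonal (fun i => hM.eigenvalues i ^ t) *
        star (hM.eigenvectorUnitary : Matrix N N ℝ)
  else M

/-- The weighted geometric mean `A #_t B = A^{1/2} (A^{-1/2} B A^{-1/2})^t A^{1/2}`
of positive definite real matrices. -/
noncomputable def wgm {N : Type*} [Fintype N] [DecidableEq N]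
    (A B : Matrix N N ℝ) (t : ℝ) : Matrix N N ℝ :=
  mpow A (1 / 2) *
    mpow ((mpow A (1 / 2))⁻¹ * B * (mpow A (1 / 2))⁻¹) t *
      mpow A (1 / 2)

theorem mpow_posDef {N : Type*} [Fintype N] [DecidableEq N] {M : Matrix N N ℝ}
    (hM : M.PosDef) (s : ℝ) : (mpow M s).PosDef := by
  rw [mpow, dif_pos hM.1]
  have h : IsUnit (star (hM.1.eigenvectorUnitary : Matrix N N ℝ)) :=
    (Unitary.toUnits (star hM.1.eigenvectorUnitary)).isUnit
  simpa using (Matrix.IsUnit.posDef_star_left_conjugate_iff h).2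
    (Matrix.PosDef.diagonal fun i => Real.rpow_pos_of_pos (hM.eigenvalues_pos i) s)

theorem mpow_half_mul_self {N : Type*} [Fintype N] [DecidableEq N] {M : Matrix N N ℝ}
    (hM : M.PosDef) : mpow M (1 / 2) * mpow M (1 / 2) = M := by
  have hU := Unitary.coe_star_mul_self hM.1.eigenvectorUnitary
  rw [mpow, dif_pos hM.1]
  set U := (hM.1.eigenvectorUnitary : Matrix N N ℝ)
  have hD : Matrix.diagonal (fun i => hM.1.eigenvalues i ^ (1 / 2 : ℝ)) *
      Matrix.diagonal (fun i => hM.1.eigenvalues i ^ (1 / 2 : ℝ)) =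
      Matrix.diagonal hM.1.eigenvalues := by
    rw [Matrix.diagonal_mul_diagonal]
    congr 1
    ext i
    rw [← Real.rpow_add (hM.eigenvalues_pos i)]
    norm_num
  conv_rhs => rw [hM.1.spectral_theorem, Unitary.conjStarAlgAut_apply]
  calc _ = U * (Matrix.diagonal (fun i => hM.1.eigenvalues i ^ (1 / 2 : ℝ)) * (star U * U) *
      Matrix.diagonal (fun i => hM.1.eigenvalues i ^ (1 / 2 : ℝ))) * star U := by
        simp only [Matrix.mul_assoc]
    _ = _ := by
        rw [hU, Matrix.mul_one, hD]
        rfl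

/-- Simultaneous diagonalization of two positive definite matrices by congruence; the same
congruence diagonalizes their weighted geometric means. -/
theorem exists_simultaneous_diagonalization {N : Type*} [Fintype N] [DecidableEq N]
    {V W : Matrix N N ℝ} (hV : V.PosDef) (hW : W.PosDef) :
    ∃ (S : Matrix N N ℝ) (d : N → ℝ), IsUnit S ∧ (∀ i, 0 < d i) ∧ V = Sᴴ * S ∧
      W = Sᴴ * Matrix.diagonal d * S ∧
      ∀ t, wgm V W t = Sᴴ * Matrix.diagonal (fun i => d i ^ t) * S := by
  have hR := mpow_posDef hV (1 / 2)
  have hRR := mpow_half_mul_self hV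
  have hdef (t : ℝ) : wgm V W t = mpow V (1 / 2) *
    mpow ((mpow V (1 / 2))⁻¹ * W * (mpow V (1 / 2))⁻¹) t * mpow V (1 / 2) := rfl
  set R := mpow V (1 / 2)
  have hRu : IsUnit R := hR.isUnit
  have hdet : IsUnit R.det := (Matrix.isUnit_iff_isUnit_det R).1 hRu
  have hC : (R⁻¹ * W * R⁻¹).PosDef := by
    have h := (Matrix.IsUnit.posDef_star_left_conjugate_iff hR.inv.isUnit).2 hW
    rwa [Matrix.star_eq_conjTranspose, hR.inv.1.eq] at h
  have hRC : R * (R⁻¹ * W * R⁻¹) * R = W := by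
    rw [Matrix.mul_assoc, Matrix.nonsing_inv_mul_cancel_right _ _ hdet,
      Matrix.mul_nonsing_inv_cancel_left _ _ hdet]
  have hUu : IsUnit (star (hC.1.eigenvectorUnitary : Matrix N N ℝ)) :=
    (Unitary.toUnits (star hC.1.eigenvectorUnitary)).isUnit
  have hU : (hC.1.eigenvectorUnitary : Matrix N N ℝ) *
      star (hC.1.eigenvectorUnitary : Matrix N N ℝ) = 1 :=
    Unitary.coe_mul_star_self hC.1.eigenvectorUnitary
  have hmp (t : ℝ) : mpow (R⁻¹ * W * R⁻¹) t = (hC.1.eigenvectorUnitary : Matrix N N ℝ) *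
      Matrix.diagonal (fun i => hC.1.eigenvalues i ^ t) *
        star (hC.1.eigenvectorUnitary : Matrix N N ℝ) := by
    rw [mpow, dif_pos hC.1]
  have hsp : R⁻¹ * W * R⁻¹ = (hC.1.eigenvectorUnitary : Matrix N N ℝ) *
      Matrix.diagonal hC.1.eigenvalues *
        star (hC.1.eigenvectorUnitary : Matrix N N ℝ) := by
    conv_lhs => rw [hC.1.spectral_theorem, Unitary.conjStarAlgAut_apply]
    rfl
  set U := (hC.1.eigenvectorUnitary : Matrix N N ℝ)
  have hS : (star U * R)ᴴ = R * U := by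
    rw [Matrix.conjTranspose_mul, hR.1.eq, Matrix.star_eq_conjTranspose,
      Matrix.conjTranspose_conjTranspose]
  refine ⟨star U * R, hC.1.eigenvalues, hUu.mul hRu, hC.eigenvalues_pos, ?_, ?_, fun t => ?_⟩
  · rw [hS, Matrix.mul_assoc, ← Matrix.mul_assoc U, hU, Matrix.one_mul, hRR]
  · refine hRC.symm.trans ((congrArg (fun X => R * X * R) hsp).trans ?_)
    rw [hS]
    simp only [Matrix.mul_assoc]
  · rw [hdef, hmp, hS]
    simp only [Matrix.mul_assoc]

theorem det_le_one_of_diag_le_one {N : Type*} [Fintype N] [DecidableEq N] {X : Matrix N N ℝ}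
    (hX : X.PosSemidef) (h : ∀ i, X i i ≤ 1) : X.det ≤ 1 := by
  have htr : ∑ i, (hX.1.eigenvalues i - 1) ≤ 0 := by
    have h1 : X.trace = ∑ i, hX.1.eigenvalues i := hX.1.trace_eq_sum_eigenvalues
    rw [Finset.sum_sub_distrib, ← h1, Matrix.trace, ← Finset.sum_sub_distrib]
    exact Finset.sum_nonpos fun i _ => sub_nonpos.2 (h i)
  calc X.det = ∏ i, hX.1.eigenvalues i := hX.1.det_eq_prod_eigenvalues
    _ ≤ ∏ i, Real.exp (hX.1.eigenvalues i - 1) :=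
        Finset.prod_le_prod (fun i _ => hX.eigenvalues_nonneg i)
          fun i _ => by linarith [Real.add_one_le_exp (hX.1.eigenvalues i - 1)]
    _ = Real.exp (∑ i, (hX.1.eigenvalues i - 1)) := (Real.exp_sum _ _).symm
    _ ≤ 1 := Real.exp_le_one_iff.2 htr

/-- A form of Hadamard's inequality. -/
theorem det_le_prod_of_diag_le {N : Type*} [Fintype N] [DecidableEq N] {X : Matrix N N ℝ}
    (hX : X.PosSemidef) {c : N → ℝ} (hc : ∀ i, 0 < c i) (h : ∀ i, X i i ≤ c i) :
    X.det ≤ ∏ i, c i := by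
  set E : Matrix N N ℝ := Matrix.diagonal fun i => (Real.sqrt (c i))⁻¹ with hE
  have hEH : Eᴴ = E := by simp [hE]
  have hsq (i : N) : (Real.sqrt (c i))⁻¹ * (Real.sqrt (c i))⁻¹ = (c i)⁻¹ := by
    rw [← mul_inv, Real.mul_self_sqrt (hc i).le]
  have h1 := det_le_one_of_diag_le_one (hX.conjTranspose_mul_mul_same E) fun i => by
    rw [hEH, hE, Matrix.mul_diagonal, Matrix.diagonal_mul, mul_right_comm, hsq,
      inv_mul_le_iff₀ (hc i), mul_one]
    exact h i
  rw [hEH, Matrix.det_mul, Matrix.det_mul, mul_right_comm, hE, Matrix.det_diagonal,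
    ← Finset.prod_mul_distrib, Finset.prod_congr rfl fun i _ => hsq i, Finset.prod_inv_distrib,
    inv_mul_le_iff₀ (Finset.prod_pos fun i _ => hc i), mul_one] at h1
  exact h1

theorem conjTranspose_mul_diagonal_mul_apply_self {M N : Type*} [Fintype N] [DecidableEq N]
    (L : Matrix N M ℝ) (d : N → ℝ) (j : M) :
    (Lᴴ * Matrix.diagonal d * L) j j = ∑ i, L i j ^ 2 * d i := by
  rw [Matrix.mul_apply]
  simp only [Matrix.mul_diagonal, Matrix.conjTranspose_apply, star_trivial]
  exact Finset.sum_congr rfl fun i _ => by ring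

theorem wgm_posDef {N : Type*} [Fintype N] [DecidableEq N] {V W : Matrix N N ℝ}
    (hV : V.PosDef) (hW : W.PosDef) (t : ℝ) : (wgm V W t).PosDef := by
  obtain ⟨S, d, hS, hd, -, -, h⟩ := exists_simultaneous_diagonalization hV hW
  rw [h t]
  exact (Matrix.IsUnit.posDef_star_left_conjugate_iff hS).2
    (Matrix.PosDef.diagonal fun i => Real.rpow_pos_of_pos (hd i) t)

theorem log_det_wgm {N : Type*} [Fintype N] [DecidableEq N] {V W : Matrix N N ℝ}
    (hV : V.PosDef) (hW : W.PosDef) (t : ℝ) :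
    Real.log (wgm V W t).det = (1 - t) * Real.log V.det + t * Real.log W.det := by
  obtain ⟨S, d, hS, hd, h0, h1, h⟩ := exists_simultaneous_diagonalization hV hW
  have hS' : S.det ≠ 0 := ((Matrix.isUnit_iff_isUnit_det S).1 hS).ne_zero
  have hp : 0 < ∏ i, d i := Finset.prod_pos fun i _ => hd i
  rw [h t, h1, h0]
  simp only [Matrix.det_mul, Matrix.det_conjTranspose, star_trivial, Matrix.det_diagonal]
  rw [Real.finsetProd_rpow _ _ fun i _ => (hd i).le, mul_right_comm,
    mul_right_comm _ (∏ i, d i), Real.log_mul (mul_ne_zero hS' hS') (Real.rpow_pos_of_pos hp t).ne',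
    Real.log_mul (mul_ne_zero hS' hS') hp.ne', Real.log_rpow hp]
  ring

/-- The determinant of a compression of `D ^ t`, with `D` diagonal, is log-convex in `t`. -/
theorem log_det_conjTranspose_mul_diagonal_rpow_mul_le {M N : Type*} [Fintype M] [DecidableEq M]
    [Fintype N] [DecidableEq N] (K : Matrix N M ℝ) {d : N → ℝ} (hd : ∀ i, 0 < d i)
    (h0 : (Kᴴ * K).PosDef) (h1 : (Kᴴ * Matrix.diagonal d * K).PosDef) {t : ℝ}
    (h : (Kᴴ * Matrix.diagonal (fun i => d i ^ t) * K).PosDef) (ht0 : 0 ≤ t) (ht1 : t ≤ 1) :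
    Real.log (Kᴴ * Matrix.diagonal (fun i => d i ^ t) * K).det ≤
      (1 - t) * Real.log (Kᴴ * K).det +
        t * Real.log (Kᴴ * Matrix.diagonal d * K).det := by
  obtain ⟨T, l, hT, hl, e0, e1, -⟩ := exists_simultaneous_diagonalization h0 h1
  have hTd : IsUnit T.det := (Matrix.isUnit_iff_isUnit_det T).1 hT
  have hT' : T.det ≠ 0 := hTd.ne_zero
  set L := K * T⁻¹ with hL
  have hK : K = L * T := by rw [hL, Matrix.nonsing_inv_mul_cancel_right _ _ hTd]
  have hconj (X : Matrix N N ℝ) : Kᴴ * X * K = Tᴴ * (Lᴴ * X * L) * T := by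
    rw [hK, Matrix.conjTranspose_mul]
    simp only [Matrix.mul_assoc]
  have hTH : IsUnit Tᴴ := hT.star
  have hcancel {X Y : Matrix M M ℝ} (hXY : Tᴴ * X * T = Tᴴ * Y * T) : X = Y :=
    hTH.mul_left_cancel (hT.mul_right_cancel hXY)
  have f0 : Lᴴ * Matrix.diagonal (fun _ : N => (1 : ℝ)) * L = 1 := by
    apply hcancel
    rw [← hconj, Matrix.diagonal_one, Matrix.mul_one, Matrix.mul_one, e0]
  have f1 : Lᴴ * Matrix.diagonal d * L = Matrix.diagonal l := by
    apply hcancel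
    rw [← hconj, e1]
  have hsum (j : M) : ∑ i, L i j ^ 2 = 1 := by
    have := conjTranspose_mul_diagonal_mul_apply_self L (fun _ => 1) j
    rw [f0, Matrix.one_apply_eq] at this
    simpa using this.symm
  have hdiag (j : M) : (Lᴴ * Matrix.diagonal (fun i => d i ^ t) * L) j j ≤ l j ^ t := by
    have := conjTranspose_mul_diagonal_mul_apply_self L d j
    rw [f1, Matrix.diagonal_apply_eq] at this
    rw [conjTranspose_mul_diagonal_mul_apply_self, this]
    exact (Real.concaveOn_rpow ht0 ht1).le_map_sum (fun i _ => sq_nonneg _) (hsum j)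
      fun i _ => (hd i).le
  have hpsd : (Lᴴ * Matrix.diagonal (fun i => d i ^ t) * L).PosSemidef :=
    (Matrix.PosDef.diagonal fun i =>
      Real.rpow_pos_of_pos (hd i) t).posSemidef.conjTranspose_mul_mul_same L
  have hdet := det_le_prod_of_diag_le hpsd (fun j => Real.rpow_pos_of_pos (hl j) t) hdiag
  have hp : 0 < ∏ j, l j := Finset.prod_pos fun j _ => hl j
  rw [Real.finsetProd_rpow _ _ fun i _ => (hl i).le] at hdet
  have hpos := h.det_pos
  rw [e1, e0]
  rw [hconj] at hpos ⊢
  simp only [Matrix.det_mul _ T, Matrix.det_mul Tᴴ, Matrix.det_conjTranspose, star_trivial,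
    Matrix.det_diagonal] at hpos ⊢
  rw [mul_right_comm] at hpos ⊢
  have hTT : 0 < T.det * T.det := mul_self_pos.2 hT'
  calc _ ≤ Real.log (T.det * T.det * (∏ j, l j) ^ t) :=
        Real.log_le_log hpos (mul_le_mul_of_nonneg_left hdet hTT.le)
    _ = _ := by
        rw [mul_right_comm T.det (∏ j, l j), Real.log_mul hTT.ne' (Real.rpow_pos_of_pos hp t).ne',
          Real.log_mul hTT.ne' hp.ne', Real.log_rpow hp]
        ring

/-- The log-determinant of a principal submatrix is convex along the weighted geometric mean. -/
theorem log_det_submatrix_wgm_le {M N : Type*} [Fintype M] [DecidableEq M]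
    [Fintype N] [DecidableEq N] {V W : Matrix N N ℝ} (hV : V.PosDef) (hW : W.PosDef) {t : ℝ}
    (ht0 : 0 ≤ t) (ht1 : t ≤ 1) {e : M → N} (he : Function.Injective e) :
    Real.log ((wgm V W t).submatrix e e).det ≤
      (1 - t) * Real.log (V.submatrix e e).det + t * Real.log (W.submatrix e e).det := by
  have hG := (wgm_posDef hV hW t).submatrix he
  have hV' := hV.submatrix he
  have hW' := hW.submatrix he
  obtain ⟨S, d, -, hd, h0, h1, h⟩ := exists_simultaneous_diagonalization hV hW
  have hsub (X : Matrix N N ℝ) :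
      (Sᴴ * X * S).submatrix e e = (S.submatrix id e)ᴴ * X * S.submatrix id e := rfl
  have hsub' : (Sᴴ * S).submatrix e e = (S.submatrix id e)ᴴ * S.submatrix id e := rfl
  rw [h t, hsub] at hG ⊢
  rw [h1, hsub] at hW' ⊢
  rw [h0, hsub'] at hV' ⊢
  exact log_det_conjTranspose_mul_diagonal_rpow_mul_le _ hd hV' hW' hG ht0 ht1

theorem IM2_eq {α β : Type*} [Fintype α] [Fintype β] [DecidableEq α] [DecidableEq β]
    {V : Matrix (α ⊕ β) (α ⊕ β) ℝ} (hV : V.PosDef) :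
    IM2 V = (1 / 2) * (Real.log (V.submatrix Sum.inl Sum.inl).det +
      Real.log (V.submatrix Sum.inr Sum.inr).det - Real.log V.det) := by
  have hA := (hV.submatrix (e := Sum.inl) Sum.inl_injective).det_pos.ne'
  have hB := (hV.submatrix (e := Sum.inr) Sum.inr_injective).det_pos.ne'
  rw [← Real.log_mul hA hB, ← Real.log_div (mul_ne_zero hA hB) hV.det_pos.ne']
  rfl

/-- the log-det mutual information is convex along the weighted geometric
mean: `I_M(A:B)_{V #_t W} ≤ (1−t)·I_M(A:B)_V + t·I_M(A:B)_W`. -/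
theorem stmt2 {nA nB : ℕ}
    (V W : Matrix (Fin nA ⊕ Fin nB) (Fin nA ⊕ Fin nB) ℝ)
    (hV : V.PosDef) (hW : W.PosDef) (t : ℝ) (ht0 : 0 ≤ t) (ht1 : t ≤ 1) :
    IM2 (wgm V W t) ≤ (1 - t) * IM2 V + t * IM2 W := by
  rw [IM2_eq (wgm_posDef hV hW t), IM2_eq hV, IM2_eq hW, log_det_wgm hV hW]
  have hA := log_det_submatrix_wgm_le hV hW ht0 ht1
    (Sum.inl_injective : Function.Injective (Sum.inl : Fin nA → Fin nA ⊕ Fin nB))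
  have hB := log_det_submatrix_wgm_le hV hW ht0 ht1
    (Sum.inr_injective : Function.Injective (Sum.inr : Fin nB → Fin nA ⊕ Fin nB))
  linarith
end

section
/- Let V_ABC be a real positive definite matrix with 3×3 block structure over components A, B, C. Then I_M(A:B|C)_V = 0 if and only if the off-diagonal block of the inverse V_ABC⁻¹ connecting the A components to the B components is zero, i.e. the principal submatrix of V_ABC⁻¹ on the union of the A and B components is the block-diagonal direct sum (V⁻¹)_A ⊕ (V⁻¹)_B. -/
open Matrix

theorem Finset.one_add_sum_le_prod_one_add_of_nonneg {ι : Type*} (s : Finset ι) {f : ι → ℝ}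
    (hf : ∀ i ∈ s, 0 ≤ f i) : 1 + ∑ i ∈ s, f i ≤ ∏ i ∈ s, (1 + f i) := by
  classical
  induction s using Finset.induction_on with
  | empty => simp
  | insert a s ha ih =>
    rw [Finset.sum_insert ha, Finset.prod_insert ha]
    have h := ih fun i hi => hf i (Finset.mem_insert_of_mem hi)
    have h0 := hf a (Finset.mem_insert_self a s)
    have h1 := Finset.sum_nonneg fun i hi => hf i (Finset.mem_insert_of_mem hi)
    nlinarith [mul_nonneg h0 h1, mul_le_mul_of_nonneg_left h h0]

/-- Jacobi's complementary minor identity for complementary principal blocks. -/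
theorem det_toBlocks₂₂_eq_det_mul_det_inv_toBlocks₁₁ {m n R : Type*} [Fintype m] [Fintype n]
    [DecidableEq m] [DecidableEq n] [CommRing R] (M : Matrix (m ⊕ n) (m ⊕ n) R)
    (hM : IsUnit M.det) : M.toBlocks₂₂.det = M.det * M⁻¹.toBlocks₁₁.det := by
  have h : M * fromBlocks M⁻¹.toBlocks₁₁ 0 M⁻¹.toBlocks₂₁ 1 =
      fromBlocks 1 M.toBlocks₁₂ 0 M.toBlocks₂₂ := by
    have h1 := mul_nonsing_inv M hM
    rw [← fromBlocks_toBlocks M, ← fromBlocks_toBlocks (fromBlocks _ _ _ _)⁻¹,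
      fromBlocks_multiply, ← fromBlocks_one, fromBlocks_inj] at h1
    rw [fromBlocks_toBlocks M] at h1
    conv_lhs => rw [← fromBlocks_toBlocks M, fromBlocks_multiply]
    simp [fromBlocks_toBlocks, h1.1, h1.2.2.1]
  simpa [det_fromBlocks_zero₁₂, det_fromBlocks_zero₂₁] using (congrArg det h).symm

/-- Jacobi's complementary minor identity for principal submatrices. -/
theorem det_submatrix_inr_eq_det_mul_det_inv_submatrix_inl {l m n R : Type*} [Fintype l]
    [Fintype m] [Fintype n] [DecidableEq l] [DecidableEq m] [DecidableEq n] [CommRing R]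
    (M : Matrix l l R) (hM : IsUnit M.det) (e : m ⊕ n ≃ l) :
    (M.submatrix (e ∘ Sum.inr) (e ∘ Sum.inr)).det =
      M.det * (M⁻¹.submatrix (e ∘ Sum.inl) (e ∘ Sum.inl)).det := by
  have h := det_toBlocks₂₂_eq_det_mul_det_inv_toBlocks₁₁ (M.submatrix e e)
    (by rwa [det_submatrix_equiv_self])
  rwa [det_submatrix_equiv_self, inv_submatrix_equiv] at h

theorem Matrix.PosSemidef.one_add_trace_le_det_one_add {n : Type*} [Fintype n] [DecidableEq n]
    {K : Matrix n n ℝ} (hK : K.PosSemidef) : 1 + K.trace ≤ (1 + K).det := by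
  have h : (1 + K).det = ∏ i, (1 + hK.1.eigenvalues i) := by
    have h1 := K.eval_charpoly (-1)
    have h2 : scalar n (-1 : ℝ) - K = -(1 + K) := by
      rw [map_neg, map_one]; abel
    rw [hK.1.charpoly_eq, h2, det_neg, Polynomial.eval_prod] at h1
    have h3 : ∏ i, (1 + hK.1.eigenvalues i) =
        (-1) ^ Fintype.card n * ∏ i, (-1 - hK.1.eigenvalues i) := by
      rw [← Finset.card_univ, ← Finset.prod_const, ← Finset.prod_mul_distrib]
      exact Finset.prod_congr rfl fun i _ => by ring
    simp only [Polynomial.eval_sub, Polynomial.eval_X, Polynomial.eval_C, RCLike.ofReal_real_eq_id,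
      id_eq] at h1
    rw [h3, h1, ← mul_assoc, ← mul_pow]
    simp
  rw [h, hK.1.trace_eq_sum_eigenvalues]
  exact Finset.one_add_sum_le_prod_one_add_of_nonneg _ fun i _ => hK.eigenvalues_nonneg i

open scoped MatrixOrder in
theorem Matrix.PosDef.exists_isUnit_conjTranspose_mul_self {n : Type*} [Fintype n]
    [DecidableEq n] {S : Matrix n n ℝ} (hS : S.PosDef) :
    ∃ L : Matrix n n ℝ, IsUnit L.det ∧ S = Lᴴ * L := by
  obtain ⟨L, rfl⟩ := CStarAlgebra.nonneg_iff_eq_star_mul_self.mp hS.posSemidef.nonneg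
  refine ⟨L, ?_, rfl⟩
  have h := hS.det_pos.ne'
  rw [det_mul] at h
  exact (right_ne_zero_of_mul h).isUnit

theorem Matrix.PosDef.eq_zero_of_det_add_eq {n : Type*} [Fintype n] [DecidableEq n]
    {S K : Matrix n n ℝ} (hS : S.PosDef) (hK : K.PosSemidef) (h : (S + K).det = S.det) :
    K = 0 := by
  obtain ⟨L, hL, rfl⟩ := hS.exists_isUnit_conjTranspose_mul_self
  have hLinv : L⁻¹ * L = 1 := nonsing_inv_mul L hL
  have hLinv' : Lᴴ * L⁻¹ᴴ = 1 := by rw [← conjTranspose_mul, hLinv, conjTranspose_one]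
  have hK' := hK.conjTranspose_mul_mul_same L⁻¹
  have hKL : Lᴴ * (L⁻¹ᴴ * K * L⁻¹) * L = K := by
    calc _ = (Lᴴ * L⁻¹ᴴ) * K * (L⁻¹ * L) := by simp only [Matrix.mul_assoc]
      _ = K := by rw [hLinv, hLinv', Matrix.one_mul, Matrix.mul_one]
  have hsum : Lᴴ * L + K = Lᴴ * (1 + L⁻¹ᴴ * K * L⁻¹) * L := by
    rw [Matrix.mul_add, Matrix.add_mul, hKL, Matrix.mul_one]
  have hdet : (1 + L⁻¹ᴴ * K * L⁻¹).det = 1 := by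
    have h0 := hS.det_pos.ne'
    rw [hsum, det_mul, det_mul] at h
    rw [det_mul] at h h0
    apply mul_left_cancel₀ h0
    linear_combination h
  have htr : (L⁻¹ᴴ * K * L⁻¹).trace = 0 :=
    le_antisymm (by linarith [hK'.one_add_trace_le_det_one_add]) hK'.trace_nonneg
  rw [← hKL, hK'.trace_eq_zero_iff.mp htr, Matrix.mul_zero, Matrix.zero_mul]

/-- The equality case of Fischer's inequality. -/
theorem Matrix.PosDef.det_eq_mul_det_iff_toBlocks₁₂_eq_zero {m n : Type*} [Fintype m]
    [Fintype n] [DecidableEq m] [DecidableEq n] {P : Matrix (m ⊕ n) (m ⊕ n) ℝ} (hP : P.PosDef) :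
    P.toBlocks₁₁.det * P.toBlocks₂₂.det = P.det ↔ P.toBlocks₁₂ = 0 := by
  have hA : P.toBlocks₁₁.PosDef := hP.submatrix Sum.inl_injective
  have hBC : P.toBlocks₂₁ = P.toBlocks₁₂ᴴ := by
    ext i j
    exact (hP.1.apply _ _).symm
  let := hA.isUnit.invertible
  have hPB : fromBlocks P.toBlocks₁₁ P.toBlocks₁₂ P.toBlocks₁₂ᴴ P.toBlocks₂₂ = P := by
    rw [← hBC, fromBlocks_toBlocks]
  set A := P.toBlocks₁₁
  set B := P.toBlocks₁₂
  set D := P.toBlocks₂₂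
  have hdet : P.det = A.det * (D - Bᴴ * A⁻¹ * B).det := by
    rw [← hPB, det_fromBlocks₁₁, invOf_eq_nonsing_inv]
  have hS : (D - Bᴴ * A⁻¹ * B).PosDef := by
    have h := (PosDef.fromBlocks₁₁ B D hA).mp (hPB ▸ hP.posSemidef)
    rw [h.posDef_iff_det_ne_zero]
    have := hP.det_pos.ne'
    rw [hdet] at this
    exact right_ne_zero_of_mul this
  constructor
  · intro h
    rw [hdet] at h
    have hK := hS.eq_zero_of_det_add_eq (hA.inv.posSemidef.conjTranspose_mul_mul_same B)
      (by rw [sub_add_cancel]; exact mul_left_cancel₀ hA.det_pos.ne' h)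
    obtain ⟨L, hL, hAL⟩ := hA.inv.exists_isUnit_conjTranspose_mul_self
    have hLB : (L * B)ᴴ * (L * B) = 0 := by
      rw [← hK, hAL, conjTranspose_mul]
      simp only [Matrix.mul_assoc]
    rw [conjTranspose_mul_self_eq_zero] at hLB
    rw [← Matrix.one_mul B, ← nonsing_inv_mul L hL, Matrix.mul_assoc, hLB, Matrix.mul_zero]
  · intro h
    rw [hdet, h]
    simp

/-- `I_M(A:B|C)_V = 0` iff the principal submatrix of `V⁻¹` on the `AB`
indices is the block-diagonal direct sum `(V⁻¹)_A ⊕ (V⁻¹)_B`. -/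
theorem stmt4 {nA nB nC : ℕ}
    (V : Matrix (Fin nA ⊕ (Fin nB ⊕ Fin nC)) (Fin nA ⊕ (Fin nB ⊕ Fin nC)) ℝ)
    (hV : V.PosDef) :
    IM3 V = 0 ↔
      V⁻¹.submatrix eAB eAB =
        fromBlocks (V⁻¹.submatrix eA eA) 0 0 (V⁻¹.submatrix eB eB) := by
  have hu : IsUnit V.det := hV.det_pos.ne'.isUnit
  have hAC : (V.submatrix eAC eAC).det = V.det * (V⁻¹.submatrix eB eB).det :=
    det_submatrix_inr_eq_det_mul_det_inv_submatrix_inl V hu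
      (⟨Sum.elim eB eAC, Sum.elim (Sum.inr ∘ Sum.inl) (Sum.elim Sum.inl (Sum.inr ∘ Sum.inr)),
        by rintro (_ | _ | _) <;> rfl, by rintro (_ | _ | _) <;> rfl⟩)
  have hBC : (V.submatrix eBC eBC).det = V.det * (V⁻¹.submatrix eA eA).det :=
    det_submatrix_inr_eq_det_mul_det_inv_submatrix_inl V hu (Equiv.refl _)
  have hC : (V.submatrix eC eC).det = V.det * (V⁻¹.submatrix eAB eAB).det := by
    convert det_submatrix_inr_eq_det_mul_det_inv_submatrix_inl V hu (Equiv.sumAssoc _ _ _)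
      using 4 <;> (ext (_ | _) <;> rfl)
  have hP : (V⁻¹.submatrix eAB eAB).PosDef :=
    hV.inv.submatrix (Function.injective_id.sumMap Sum.inl_injective)
  have hA : (V⁻¹.submatrix eA eA).PosDef := hV.inv.submatrix Sum.inl_injective
  have hB : (V⁻¹.submatrix eB eB).PosDef :=
    hV.inv.submatrix (Sum.inr_injective.comp Sum.inl_injective)
  have hratio : (V.submatrix eAC eAC).det * (V.submatrix eBC eBC).det /
      ((V.submatrix eC eC).det * V.det) =
      (V⁻¹.submatrix eA eA).det * (V⁻¹.submatrix eB eB).det / (V⁻¹.submatrix eAB eAB).det := by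
    have := hV.det_pos.ne'
    have := hP.det_pos.ne'
    rw [hAC, hBC, hC]
    field_simp
  have hpos := div_pos (mul_pos hA.det_pos hB.det_pos) hP.det_pos
  have hlog : IM3 V = 0 ↔ (V⁻¹.submatrix eA eA).det * (V⁻¹.submatrix eB eB).det =
      (V⁻¹.submatrix eAB eAB).det := by
    rw [IM3, hratio, mul_eq_zero_iff_left (by norm_num), ← div_eq_one_iff_eq hP.det_pos.ne']
    exact ⟨Real.eq_one_of_pos_of_log_eq_zero hpos, fun h => by rw [h, Real.log_one]⟩
  rw [hlog]
  refine hP.det_eq_mul_det_iff_toBlocks₁₂_eq_zero.trans ⟨fun h => ?_, fun h => ?_⟩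
  · have h21 : (V⁻¹.submatrix eAB eAB).toBlocks₂₁ = 0 := by
      ext i j
      exact (hP.1.apply (Sum.inr i) (Sum.inl j)).symm.trans (congrFun (congrFun h j) i)
    rw [← fromBlocks_toBlocks (V⁻¹.submatrix eAB eAB), h, h21]
    rfl
  · rw [h, toBlocks_fromBlocks₁₂]
end

section
/- Let V_ABC be a real positive definite matrix with 3×3 block structure over components A, B, C. Then I_M(A:B|C)_V = 0 if and only if V_ABC/V_BC = V_AC/V_C, where V_ABC/V_BC is the Schur complement of V_ABC with respect to the principal submatrix V_BC on the B and C components, and V_AC/V_C is the Schur complement of the principal submatrix V_AC with respect to V_C. -/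
open Matrix

namespace Matrix

variable {l m n : Type*} [Fintype l] [Fintype m] [Fintype n]
  [DecidableEq m] [DecidableEq n]

lemma PosSemidef.det_one_add {E : Matrix n n ℝ} (hE : E.PosSemidef) :
    (1 + E).det = ∏ i, (1 + hE.isHermitian.eigenvalues i) := by
  conv_lhs => rw [hE.isHermitian.spectral_theorem,
    ← map_one (Unitary.conjStarAlgAut ℝ _ hE.isHermitian.eigenvectorUnitary), ← map_add,
    Unitary.conjStarAlgAut_apply, det_mul_right_comm,
    Unitary.mul_star_self_of_mem (SetLike.coe_mem _), one_mul,
    ← diagonal_one, diagonal_add, det_diagonal]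
  simp

lemma PosSemidef.eq_zero_of_det_one_add_eq_one {E : Matrix n n ℝ} (hE : E.PosSemidef)
    (h : (1 + E).det = 1) : E = 0 := by
  rw [hE.det_one_add] at h
  rw [← hE.isHermitian.eigenvalues_eq_zero_iff]
  funext i
  have hone (j : n) : 1 ≤ 1 + hE.isHermitian.eigenvalues j :=
    le_add_of_nonneg_right (hE.eigenvalues_nonneg j)
  have hle : 1 + hE.isHermitian.eigenvalues i ≤ ∏ j, (1 + hE.isHermitian.eigenvalues j) := by
    simpa using Finset.prod_le_prod_of_subset_of_one_le (Finset.subset_univ {i})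
      (fun j _ => zero_le_one.trans (hone j)) (fun j _ _ => hone j)
  have := hE.eigenvalues_nonneg i
  simp only [Pi.zero_apply]
  linarith

/-- The determinant separates comparable positive definite matrices. -/
lemma PosDef.eq_of_posSemidef_sub_of_det_eq {S T : Matrix n n ℝ} (hS : S.PosDef)
    (hST : (T - S).PosSemidef) (hdet : T.det = S.det) : T = S := by
  obtain ⟨B, hB⟩ : ∃ B : Matrix n n ℝ, S = Bᴴ * B := by
    open scoped MatrixOrder in
    exact CStarAlgebra.nonneg_iff_eq_star_mul_self.mp hS.posSemidef.nonneg
  have hBdet : IsUnit B.det := by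
    have := hS.det_pos.ne'
    rw [hB, det_mul] at this
    exact (right_ne_zero_of_mul this).isUnit
  have hBdet' : IsUnit Bᴴ.det := by rwa [det_conjTranspose, isUnit_star]
  set E : Matrix n n ℝ := (B⁻¹)ᴴ * (T - S) * B⁻¹ with hE
  have hTS : T - S = Bᴴ * E * B := by
    rw [hE, conjTranspose_nonsing_inv, Matrix.mul_assoc, Matrix.mul_assoc, Matrix.mul_assoc,
      nonsing_inv_mul _ hBdet, Matrix.mul_one, mul_nonsing_inv_cancel_left _ _ hBdet']
  have hT : T = Bᴴ * (1 + E) * B := by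
    rw [Matrix.mul_add, Matrix.add_mul, ← hTS, Matrix.mul_one, ← hB, add_sub_cancel]
  have hdetE : (1 + E).det = 1 := by
    have hTdet : T.det = S.det * (1 + E).det := by
      rw [hT, hB, det_mul, det_mul, det_mul]; ring
    exact (mul_eq_left₀ hS.det_pos.ne').mp (hTdet.symm.trans hdet)
  have hE0 := (hST.conjTranspose_mul_mul_same B⁻¹).eq_zero_of_det_one_add_eq_one hdetE
  rw [← sub_eq_zero, hTS, hE, hE0, Matrix.mul_zero, Matrix.zero_mul]

/-- Passing to a principal submatrix of the pivot block increases the Schur complement. -/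
lemma PosDef.posSemidef_schur_sub_schur {D : Matrix n n ℝ} (hD : D.PosDef) (A : Matrix l l ℝ)
    (X : Matrix l n ℝ) {e : m → n} (he : Function.Injective e) :
    ((A - X.submatrix id e * (D.submatrix e e)⁻¹ * (X.submatrix id e)ᴴ) -
      (A - X * D⁻¹ * Xᴴ)).PosSemidef := by
  have hDe := hD.submatrix he
  let := hD.isUnit.invertible
  let := hDe.isUnit.invertible
  have hV : (fromBlocks (X * D⁻¹ * Xᴴ) X Xᴴ D).PosSemidef := by
    rw [PosDef.fromBlocks₂₂ _ _ hD, sub_self]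
    exact .zero
  have hVe := hV.submatrix (Sum.map id e)
  have hblocks : (fromBlocks (X * D⁻¹ * Xᴴ) X Xᴴ D).submatrix (Sum.map id e) (Sum.map id e) =
      fromBlocks (X * D⁻¹ * Xᴴ) (X.submatrix id e) (X.submatrix id e)ᴴ (D.submatrix e e) := by
    ext (i | i) (j | j) <;> rfl
  rw [hblocks, PosDef.fromBlocks₂₂ _ _ hDe] at hVe
  rwa [sub_sub_sub_cancel_left]

/-- The two Schur complements agree as soon as their determinants do. -/
lemma PosDef.det_schur_eq_iff [DecidableEq l] {A : Matrix l l ℝ} {X : Matrix l n ℝ}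
    {D : Matrix n n ℝ} (hV : (fromBlocks A X Xᴴ D).PosDef) {e : m → n} (he : Function.Injective e) :
    (A - X.submatrix id e * (D.submatrix e e)⁻¹ * (X.submatrix id e)ᴴ).det =
        (A - X * D⁻¹ * Xᴴ).det ↔
      A - X * D⁻¹ * Xᴴ = A - X.submatrix id e * (D.submatrix e e)⁻¹ * (X.submatrix id e)ᴴ := by
  have hD : D.PosDef := hV.submatrix Sum.inr_injective
  let := hD.isUnit.invertible
  have hS : (A - X * D⁻¹ * Xᴴ).PosDef := by
    have hpsd := (PosDef.fromBlocks₂₂ A X hD).mp hV.posSemidef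
    have hdet := hV.det_pos.ne'
    rw [det_fromBlocks₂₂, invOf_eq_nonsing_inv] at hdet
    exact hpsd.posDef_iff_det_ne_zero.mpr (right_ne_zero_of_mul hdet)
  exact ⟨fun h => (hS.eq_of_posSemidef_sub_of_det_eq
    (hD.posSemidef_schur_sub_schur A X he) h).symm, fun h => by rw [h]⟩

end Matrix

/-- `I_M(A:B|C)_V = 0` iff `V_ABC/V_BC = V_AC/V_C`. -/
theorem stmt5 {nA nB nC : ℕ}
    (V : Matrix (Fin nA ⊕ (Fin nB ⊕ Fin nC)) (Fin nA ⊕ (Fin nB ⊕ Fin nC)) ℝ)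
    (hV : V.PosDef) :
    IM3 V = 0 ↔
      V.submatrix eA eA -
          V.submatrix eA eBC * (V.submatrix eBC eBC)⁻¹ * V.submatrix eBC eA =
        V.submatrix eA eA -
          V.submatrix eA eC * (V.submatrix eC eC)⁻¹ * V.submatrix eC eA := by
  have hfull : V = fromBlocks (V.submatrix eA eA) (V.submatrix eA eBC) (V.submatrix eA eBC)ᴴ
      (V.submatrix eBC eBC) := by
    ext (i | i) (j | j)
    · rfl
    · rfl
    · exact (hV.isHermitian.apply _ _).symm
    · rfl
  have hAC : V.submatrix eAC eAC = fromBlocks (V.submatrix eA eA) (V.submatrix eA eC)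
      (V.submatrix eC eA) (V.submatrix eC eC) := by
    ext (i | i) (j | j) <;> rfl
  have hXBC : V.submatrix eBC eA = (V.submatrix eA eBC)ᴴ := by
    rw [conjTranspose_submatrix, hV.isHermitian.eq]
  have hXC : V.submatrix eC eA = (V.submatrix eA eC)ᴴ := by
    rw [conjTranspose_submatrix, hV.isHermitian.eq]
  have hBC : (V.submatrix eBC eBC).PosDef := hV.submatrix Sum.inr_injective
  have hC : (V.submatrix eC eC).PosDef :=
    hV.submatrix (Sum.inr_injective.comp Sum.inr_injective)
  have hACpos : (V.submatrix eAC eAC).PosDef :=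
    hV.submatrix (Function.injective_id.sumMap Sum.inr_injective)
  let := hBC.isUnit.invertible
  let := hC.isUnit.invertible
  have hdetV : V.det = (V.submatrix eBC eBC).det * (V.submatrix eA eA -
      V.submatrix eA eBC * (V.submatrix eBC eBC)⁻¹ * (V.submatrix eA eBC)ᴴ).det := by
    conv_lhs => rw [hfull, det_fromBlocks₂₂, invOf_eq_nonsing_inv]
  have hdetAC : (V.submatrix eAC eAC).det = (V.submatrix eC eC).det * (V.submatrix eA eA -
      V.submatrix eA eC * (V.submatrix eC eC)⁻¹ * (V.submatrix eA eC)ᴴ).det := by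
    rw [hAC, det_fromBlocks₂₂, invOf_eq_nonsing_inv, hXC]
  have hiff := (hfull ▸ hV : (fromBlocks (V.submatrix eA eA) (V.submatrix eA eBC)
    (V.submatrix eA eBC)ᴴ (V.submatrix eBC eBC)).PosDef).det_schur_eq_iff
      (Sum.inr_injective : Function.Injective (Sum.inr : Fin nC → Fin nB ⊕ Fin nC))
  rw [hXBC, hXC]
  refine Iff.trans ?_ hiff
  have hratio : 0 < (V.submatrix eAC eAC).det * (V.submatrix eBC eBC).det /
      ((V.submatrix eC eC).det * V.det) :=
    div_pos (mul_pos hACpos.det_pos hBC.det_pos) (mul_pos hC.det_pos hV.det_pos)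
  rw [IM3, mul_eq_zero_iff_left (by norm_num), ← Real.log_one,
    Real.log_injOn_pos.eq_iff hratio (Set.mem_Ioi.mpr one_pos),
    div_eq_one_iff_eq (mul_pos hC.det_pos hV.det_pos).ne', hdetV, hdetAC, mul_assoc,
    mul_right_inj' hC.det_pos.ne', mul_comm, mul_right_inj' hBC.det_pos.ne']
  rfl
end

section
/- Let V_ABC be a real positive definite matrix with 3×3 block structure over components A, B, C (of sizes n_A, n_B, n_C). Then I_M(A:B|C)_V = 0 if and only if there exist a real (n_B+n_C)×n_C matrix H and a real positive semidefinite (n_B+n_C)×(n_B+n_C) matrix K such that T V_AC Tᵀ + (0_{n_A} ⊕ K) = V_ABC, where T is the (n_A+n_B+n_C)×(n_A+n_C) matrix acting as the identity from the A components to the A components and as H from the C components to the B and C components (i.e. V_ABC is obtained from the marginal V_AC by a classical Gaussian channel acting only on C and outputting BC). -/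
open Matrix

namespace Matrix

lemma conjTranspose_mul_mul_same_apply_self {m n : Type*} [Fintype m]
    (K : Matrix m m ℝ) (X : Matrix m n ℝ) (j : n) :
    (Xᴴ * K * X) j j = star (X.col j) ⬝ᵥ K *ᵥ X.col j := by
  rw [Matrix.mul_assoc]
  simp [Matrix.mul_apply, dotProduct, mulVec]

lemma PosDef.eq_zero_of_conjTranspose_mul_mul_same_eq_zero {m n : Type*} [Fintype m]
    {C : Matrix m m ℝ} (hC : C.PosDef) {X : Matrix m n ℝ} (h : Xᴴ * C * X = 0) : X = 0 := by
  ext i j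
  by_contra hx
  have h_pos := hC.dotProduct_mulVec_pos (x := X.col j) fun h_zero => hx (congrFun h_zero i)
  rw [← conjTranspose_mul_mul_same_apply_self, h] at h_pos
  simp at h_pos

lemma PosSemidef.mul_eq_zero_of_conjTranspose_mul_mul_same_eq_zero {m n : Type*} [Fintype m]
    {K : Matrix m m ℝ} (hK : K.PosSemidef) {X : Matrix m n ℝ} (h : Xᴴ * K * X = 0) :
    K * X = 0 := by
  ext i j
  have h_zero := conjTranspose_mul_mul_same_apply_self K X j
  rw [h] at h_zero
  exact congrFun ((hK.dotProduct_mulVec_zero_iff _).1 h_zero.symm) i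

lemma IsHermitian.det_one_add_eq_prod {n : Type*} [Fintype n] [DecidableEq n]
    {N : Matrix n n ℝ} (hN : N.IsHermitian) : (1 + N).det = ∏ i, (1 + hN.eigenvalues i) := by
  have h_char := congrArg (Polynomial.eval (-1)) hN.charpoly_eq
  have h_neg : scalar n (-1 : ℝ) - N = -(1 + N) := by
    rw [map_neg, map_one]
    abel
  have h_prod : ∏ i, Polynomial.eval (-1) (Polynomial.X - Polynomial.C (hN.eigenvalues i : ℝ)) =
      (-1) ^ Fintype.card n * ∏ i, (1 + hN.eigenvalues i) := by
    rw [← Finset.card_univ, ← Finset.prod_const, ← Finset.prod_mul_distrib]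
    refine Finset.prod_congr rfl fun i _ => ?_
    simp only [Polynomial.eval_sub, Polynomial.eval_X, Polynomial.eval_C]
    ring
  rw [Matrix.eval_charpoly, Polynomial.eval_prod, h_neg, det_neg] at h_char
  exact mul_left_cancel₀ (pow_ne_zero _ (by norm_num)) (h_char.trans h_prod)

lemma PosSemidef.eq_zero_of_det_one_add_eq_one_s6 {n : Type*} [Fintype n] [DecidableEq n]
    {N : Matrix n n ℝ} (hN : N.PosSemidef) (h : (1 + N).det = 1) : N = 0 := by
  refine hN.1.eigenvalues_eq_zero_iff.1 (funext fun i => ?_)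
  by_contra hi
  have h_lt : ∏ _j : n, (1 : ℝ) < ∏ j, (1 + hN.1.eigenvalues j) :=
    Finset.prod_lt_prod (fun _ _ => one_pos)
      (fun j _ => le_add_of_nonneg_right (hN.eigenvalues_nonneg j))
      ⟨i, Finset.mem_univ i,
        lt_add_of_pos_right 1 (lt_of_le_of_ne (hN.eigenvalues_nonneg i) (Ne.symm hi))⟩
  rw [← hN.1.det_one_add_eq_prod, h] at h_lt
  simp at h_lt

open scoped MatrixOrder in
/-- Adding a nonzero positive semidefinite matrix of the form `B C Bᴴ`, with `C` positive definite,
to a positive definite matrix changes its determinant. -/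
lemma PosDef.det_add_mul_mul_conjTranspose_eq_iff {m n : Type*} [Fintype m] [Fintype n]
    [DecidableEq m] {A : Matrix m m ℝ} {C : Matrix n n ℝ} (hA : A.PosDef)
    (hC : C.PosDef) (B : Matrix m n ℝ) :
    (A + B * C * Bᴴ).det = A.det ↔ B = 0 := by
  classical
  refine ⟨fun h => ?_, fun h => by simp [h]⟩
  have h_psd : (B * C * Bᴴ).PosSemidef := hC.posSemidef.mul_mul_conjTranspose_same B
  obtain ⟨F, hF⟩ := CStarAlgebra.nonneg_iff_eq_star_mul_self.mp h_psd.nonneg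
  rw [star_eq_conjTranspose] at hF
  rw [hF, det_add_mul _ _ ((isUnit_iff_isUnit_det A).1 hA.isUnit),
    mul_eq_left₀ hA.det_pos.ne'] at h
  have h_zero := (hA.inv.posSemidef.mul_mul_conjTranspose_same F).eq_zero_of_det_one_add_eq_one_s6 h
  have h_F : Fᴴ = 0 := hA.inv.eq_zero_of_conjTranspose_mul_mul_same_eq_zero (by simpa using h_zero)
  rw [h_F, Matrix.zero_mul] at hF
  exact conjTranspose_eq_zero.1
    (hC.eq_zero_of_conjTranspose_mul_mul_same_eq_zero (by simpa using hF))

section SchurComplement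

variable {m n : Type*} [Fintype m] [Fintype n] [DecidableEq m] [DecidableEq n]
  {A : Matrix m m ℝ} {B : Matrix m n ℝ} {D : Matrix n n ℝ}

lemma det_fromBlocks_eq_det_mul_det_schur (hD : D.PosDef) :
    (fromBlocks A B Bᴴ D).det = D.det * (A - B * D⁻¹ * Bᴴ).det := by
  have := hD.isUnit.invertible
  rw [det_fromBlocks₂₂, invOf_eq_nonsing_inv]

lemma PosDef.schur_complement (hV : (fromBlocks A B Bᴴ D).PosDef) (hD : D.PosDef) :
    (A - B * D⁻¹ * Bᴴ).PosDef := by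
  have := hD.isUnit.invertible
  have h_det := hV.det_pos.ne'
  rw [det_fromBlocks_eq_det_mul_det_schur hD] at h_det
  exact ((PosDef.fromBlocks₂₂ A B hD).1 hV.posSemidef).posDef_iff_det_ne_zero.2
    (right_ne_zero_of_mul h_det)

/-- The equality case of **Fischer's inequality**. -/
lemma PosDef.det_fromBlocks_eq_det_mul_det_iff (hV : (fromBlocks A B Bᴴ D).PosDef) :
    A.det * D.det = (fromBlocks A B Bᴴ D).det ↔ B = 0 := by
  have hD : D.PosDef := hV.submatrix (e := Sum.inr) Sum.inr_injective
  rw [det_fromBlocks_eq_det_mul_det_schur hD, mul_comm, mul_right_inj' hD.det_pos.ne',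
    ← (hV.schur_complement hD).det_add_mul_mul_conjTranspose_eq_iff hD.inv B, sub_add_cancel]

end SchurComplement

/-- The determinant form of the vanishing of the conditional mutual information: equality holds
precisely when the off-diagonal block of the Schur complement of `c` vanishes. -/
lemma PosDef.det_mul_det_eq_det_mul_det_iff {α β γ : Type*} [Fintype α] [Fintype β] [Fintype γ]
    [DecidableEq α] [DecidableEq β] [DecidableEq γ] {a : Matrix α α ℝ} {b : Matrix β β ℝ}
    {c : Matrix γ γ ℝ} {X : Matrix α β ℝ} {Y : Matrix α γ ℝ} {Z : Matrix β γ ℝ}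
    (hV : (fromBlocks (fromBlocks a X Xᴴ b) (fromRows Y Z) (fromRows Y Z)ᴴ c).PosDef) :
    (fromBlocks a Y Yᴴ c).det * (fromBlocks b Z Zᴴ c).det = c.det *
        (fromBlocks (fromBlocks a X Xᴴ b) (fromRows Y Z) (fromRows Y Z)ᴴ c).det ↔
      X = Y * c⁻¹ * Zᴴ := by
  have hc : c.PosDef := hV.submatrix (e := Sum.inr) Sum.inr_injective
  have h_schur : fromBlocks a X Xᴴ b - fromRows Y Z * c⁻¹ * (fromRows Y Z)ᴴ =
      fromBlocks (a - Y * c⁻¹ * Yᴴ) (X - Y * c⁻¹ * Zᴴ) (X - Y * c⁻¹ * Zᴴ)ᴴ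
        (b - Z * c⁻¹ * Zᴴ) := by
    rw [conjTranspose_fromRows_eq_fromCols_conjTranspose, fromRows_mul, fromRows_mul_fromCols,
      sub_eq_add_neg, fromBlocks_neg, fromBlocks_add, ← sub_eq_add_neg, ← sub_eq_add_neg,
      ← sub_eq_add_neg, ← sub_eq_add_neg, conjTranspose_sub, conjTranspose_mul, conjTranspose_mul,
      conjTranspose_conjTranspose, hc.inv.isHermitian.eq, Matrix.mul_assoc Z]
  have h_fischer := hV.schur_complement hc
  rw [h_schur] at h_fischer
  rw [det_fromBlocks_eq_det_mul_det_schur hc, det_fromBlocks_eq_det_mul_det_schur hc,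
    det_fromBlocks_eq_det_mul_det_schur hc, h_schur, mul_mul_mul_comm,
    ← mul_assoc c.det c.det, mul_right_inj' (mul_pos hc.det_pos hc.det_pos).ne',
    h_fischer.det_fromBlocks_eq_det_mul_det_iff, sub_eq_zero]

open scoped MatrixOrder in
/-- If `c` dominates `H c Hᴴ` and `H` fixes the columns of `Yᴴ`, then `Hᴴ` fixes the columns of
`c⁻¹ Yᴴ`, and the form `c - H c Hᴴ` vanishes on them. -/
lemma PosDef.fixed_of_posSemidef_sub {α γ : Type*} [Fintype α] [Fintype γ] [DecidableEq γ]
    {c H K : Matrix γ γ ℝ} {Y : Matrix α γ ℝ} (hc : c.PosDef) (hK : K.PosSemidef)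
    (h_sum : H * c * Hᴴ + K = c) (h_fix : Y * Hᴴ = Y) :
    Y * c⁻¹ * H = Y * c⁻¹ ∧ (Y * c⁻¹) * K * (Y * c⁻¹)ᴴ = 0 := by
  have h_inv : c⁻¹ * c = 1 := nonsing_inv_mul c ((isUnit_iff_isUnit_det c).1 hc.isUnit)
  have h_cU : c * (Y * c⁻¹)ᴴ = Yᴴ := by
    rw [← hc.isHermitian.eq, ← conjTranspose_mul, hc.isHermitian.eq, Matrix.mul_assoc, h_inv,
      Matrix.mul_one]
  have h_Uc : Y * c⁻¹ * c = Y := by rw [Matrix.mul_assoc, h_inv, Matrix.mul_one]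
  set U := Y * c⁻¹
  clear_value U
  have h_fix' : H * Yᴴ = Yᴴ := by
    rw [← conjTranspose_conjTranspose H, ← conjTranspose_mul, h_fix]
  have h_expand : (U * H - U) * c * (U * H - U)ᴴ = -(U * K * Uᴴ) := by
    have h_K : K = c - H * c * Hᴴ := eq_sub_of_add_eq' h_sum
    have h_both : U * (H * c * Hᴴ) * Uᴴ = U * H * c * (U * H)ᴴ := by
      simp only [conjTranspose_mul, Matrix.mul_assoc]
    have h_left : U * H * c * Uᴴ = U * c * Uᴴ := by
      rw [Matrix.mul_assoc _ c, h_cU, Matrix.mul_assoc, h_fix', Matrix.mul_assoc, h_cU]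
    have h_right : U * c * (U * H)ᴴ = U * c * Uᴴ := by
      rw [h_Uc, conjTranspose_mul, ← Matrix.mul_assoc, h_fix]
    rw [h_K, conjTranspose_sub, Matrix.mul_sub U, Matrix.sub_mul _ _ Uᴴ, h_both, Matrix.sub_mul,
      Matrix.sub_mul, Matrix.mul_sub, Matrix.mul_sub, h_left, h_right]
    abel
  have h_nonneg := hc.posSemidef.mul_mul_conjTranspose_same (U * H - U)
  have h_zero : U * K * Uᴴ = 0 := by
    refine le_antisymm ?_ (hK.mul_mul_conjTranspose_same U).nonneg
    rw [h_expand] at h_nonneg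
    exact neg_nonneg.1 h_nonneg.nonneg
  refine ⟨?_, h_zero⟩
  rw [h_zero, neg_zero] at h_expand
  exact sub_eq_zero.1 (conjTranspose_eq_zero.1
    (hc.eq_zero_of_conjTranspose_mul_mul_same_eq_zero (by simpa using h_expand)))

end Matrix

lemma fromBlocks_submatrix_eAC {α β γ : Type*} (a : Matrix α α ℝ) (X : Matrix α β ℝ)
    (Y : Matrix α γ ℝ) (X' : Matrix β α ℝ) (Y' : Matrix γ α ℝ) (W : Matrix (β ⊕ γ) (β ⊕ γ) ℝ) :
    (fromBlocks a (fromCols X Y) (fromRows X' Y') W).submatrix eAC eAC =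
      fromBlocks a Y Y' (W.submatrix Sum.inr Sum.inr) := by
  ext (i | i) (j | j) <;> rfl

section ConditionalMutualInformation

variable {α β γ : Type*} [Fintype α] [Fintype β] [Fintype γ]
  [DecidableEq α] [DecidableEq β] [DecidableEq γ] {a : Matrix α α ℝ} {b : Matrix β β ℝ}
  {c : Matrix γ γ ℝ} {X : Matrix α β ℝ} {Y : Matrix α γ ℝ} {Z : Matrix β γ ℝ}

lemma IM3_fromBlocks_eq_zero_iff
    (hV : (fromBlocks a (fromCols X Y) (fromRows Xᴴ Yᴴ) (fromBlocks b Z Zᴴ c)).PosDef) :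
    IM3 (fromBlocks a (fromCols X Y) (fromRows Xᴴ Yᴴ) (fromBlocks b Z Zᴴ c)) = 0 ↔
      X = Y * c⁻¹ * Zᴴ := by
  have h_assoc : (fromBlocks a (fromCols X Y) (fromRows Xᴴ Yᴴ) (fromBlocks b Z Zᴴ c)).submatrix
      (Equiv.sumAssoc α β γ) (Equiv.sumAssoc α β γ) =
      fromBlocks (fromBlocks a X Xᴴ b) (fromRows Y Z) (fromRows Y Z)ᴴ c := by
    ext ((i | i) | i) ((j | j) | j) <;> rfl
  have hV' := hV.submatrix (Equiv.sumAssoc α β γ).injective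
  rw [h_assoc] at hV'
  have h_AC : (fromBlocks a (fromCols X Y) (fromRows Xᴴ Yᴴ) (fromBlocks b Z Zᴴ c)).submatrix
      eAC eAC = fromBlocks a Y Yᴴ c := fromBlocks_submatrix_eAC ..
  have h_BC : (fromBlocks a (fromCols X Y) (fromRows Xᴴ Yᴴ) (fromBlocks b Z Zᴴ c)).submatrix
      eBC eBC = fromBlocks b Z Zᴴ c := rfl
  have h_C : (fromBlocks a (fromCols X Y) (fromRows Xᴴ Yᴴ) (fromBlocks b Z Zᴴ c)).submatrix
      eC eC = c := rfl
  have hc : c.PosDef := hV'.submatrix (e := Sum.inr) Sum.inr_injective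
  have hAC := (hV.submatrix (e := eAC) (Sum.map_injective.2
    ⟨Function.injective_id, Sum.inr_injective⟩)).det_pos
  have hBC := (hV.submatrix (e := eBC) Sum.inr_injective).det_pos
  rw [h_AC] at hAC
  rw [h_BC] at hBC
  have h_pos := mul_pos hc.det_pos hV.det_pos
  rw [← hV'.det_mul_det_eq_det_mul_det_iff, ← h_assoc, det_submatrix_equiv_self, IM3, h_AC, h_BC,
    h_C, mul_eq_zero_iff_left (by norm_num), ← div_eq_one_iff_eq h_pos.ne']
  exact ⟨Real.eq_one_of_pos_of_log_eq_zero (div_pos (mul_pos hAC hBC) h_pos),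
    fun h => by rw [h, Real.log_one]⟩

lemma exists_gaussian_channel_iff
    (hV : (fromBlocks a (fromCols X Y) (fromRows Xᴴ Yᴴ) (fromBlocks b Z Zᴴ c)).PosDef) :
    (∃ (H : Matrix (β ⊕ γ) γ ℝ) (K : Matrix (β ⊕ γ) (β ⊕ γ) ℝ), K.PosSemidef ∧
      fromBlocks (1 : Matrix α α ℝ) 0 0 H * fromBlocks a Y Yᴴ c *
          (fromBlocks (1 : Matrix α α ℝ) 0 0 H)ᵀ + fromBlocks 0 0 0 K =
        fromBlocks a (fromCols X Y) (fromRows Xᴴ Yᴴ) (fromBlocks b Z Zᴴ c)) ↔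
      X = Y * c⁻¹ * Zᴴ := by
  have hW : (fromBlocks b Z Zᴴ c).PosDef := hV.submatrix (e := Sum.inr) Sum.inr_injective
  have hc : c.PosDef := hW.submatrix (e := Sum.inr) Sum.inr_injective
  have h_det := (isUnit_iff_isUnit_det c).1 hc.isUnit
  have h_inv : c⁻¹ᴴ = c⁻¹ := hc.inv.isHermitian.eq
  have h_mul : ∀ (H : Matrix (β ⊕ γ) γ ℝ) (K : Matrix (β ⊕ γ) (β ⊕ γ) ℝ),
      fromBlocks (1 : Matrix α α ℝ) 0 0 H * fromBlocks a Y Yᴴ c *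
        (fromBlocks (1 : Matrix α α ℝ) 0 0 H)ᵀ + fromBlocks 0 0 0 K =
      fromBlocks a (Y * Hᴴ) (H * Yᴴ) (H * c * Hᴴ + K) := fun H K => by
    simp [fromBlocks_transpose, fromBlocks_multiply, fromBlocks_add]
  constructor
  · rintro ⟨H, K, hK, h⟩
    obtain ⟨H₁, H₂, rfl⟩ : ∃ H₁ H₂, H = fromRows H₁ H₂ := ⟨_, _, (fromRows_toRows H).symm⟩
    obtain ⟨K₁₁, K₁₂, K₂₁, K₂₂, rfl⟩ : ∃ K₁₁ K₁₂ K₂₁ K₂₂, K = fromBlocks K₁₁ K₁₂ K₂₁ K₂₂ :=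
      ⟨_, _, _, _, (fromBlocks_toBlocks K).symm⟩
    rw [h_mul, fromBlocks_inj, conjTranspose_fromRows_eq_fromCols_conjTranspose, mul_fromCols,
      fromRows_mul, fromRows_mul, fromRows_mul_fromCols, fromBlocks_add, fromBlocks_inj] at h
    obtain ⟨-, h_top, -, -, hZ, -, h_sum⟩ := h
    obtain ⟨hX, hY⟩ := fromCols_inj h_top
    have hK₂₂ : K₂₂.PosSemidef := hK.submatrix Sum.inr
    obtain ⟨h_fix, h_ker⟩ := hc.fixed_of_posSemidef_sub hK₂₂ h_sum hY
    have h_ker' : K₁₂ * (Y * c⁻¹)ᴴ = 0 := by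
      have h_full := hK.mul_eq_zero_of_conjTranspose_mul_mul_same_eq_zero
        (X := fromRows (0 : Matrix β α ℝ) (Y * c⁻¹)ᴴ) (by
          rw [conjTranspose_fromRows_eq_fromCols_conjTranspose, fromCols_mul_fromBlocks,
            fromCols_mul_fromRows, conjTranspose_conjTranspose]
          simpa using h_ker)
      rw [fromBlocks_mul_fromRows, ← fromRows_zero] at h_full
      simpa using (fromRows_inj h_full).1
    have h_YH : Z * (Y * c⁻¹)ᴴ = H₁ * Yᴴ := by
      rw [← hZ, Matrix.add_mul, h_ker', add_zero, Matrix.mul_assoc, ← conjTranspose_mul, h_fix,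
        conjTranspose_mul, h_inv, Matrix.mul_assoc, mul_nonsing_inv_cancel_left _ _ h_det]
    rw [← hX, ← conjTranspose_inj]
    simpa using h_YH.symm
  · intro h
    have hX : Xᴴ = Z * c⁻¹ * Yᴴ := by
      rw [h, conjTranspose_mul, conjTranspose_mul, conjTranspose_conjTranspose, h_inv,
        Matrix.mul_assoc]
    have hR := hW.schur_complement hc
    refine ⟨fromRows (Z * c⁻¹) 1, fromBlocks (b - Z * c⁻¹ * Zᴴ) 0 0 0, ?_, ?_⟩
    · have h_psd := hR.posSemidef.mul_mul_conjTranspose_same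
        (fromRows (1 : Matrix β β ℝ) (0 : Matrix γ β ℝ))
      rw [conjTranspose_fromRows_eq_fromCols_conjTranspose, fromRows_mul,
        fromRows_mul_fromCols] at h_psd
      simpa using h_psd
    · rw [h_mul, conjTranspose_fromRows_eq_fromCols_conjTranspose, mul_fromCols, fromRows_mul,
        fromRows_mul, fromRows_mul_fromCols, fromBlocks_add, conjTranspose_mul, h_inv,
        ← Matrix.mul_assoc Y, ← h, ← hX, nonsing_inv_mul_cancel_right _ _ h_det,
        ← Matrix.mul_assoc Z, Matrix.one_mul c, mul_nonsing_inv_cancel_left _ _ h_det]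
      simp

end ConditionalMutualInformation

/-- `I_M(A:B|C)_V = 0` iff `V_ABC` is obtained from the marginal `V_AC` by
a classical Gaussian channel acting as the identity on `A` and as `x_C ↦ H x_C + noise`
from `C` to `BC`, with positive semidefinite noise covariance `K`. -/
theorem stmt6 {nA nB nC : ℕ}
    (V : Matrix (Fin nA ⊕ (Fin nB ⊕ Fin nC)) (Fin nA ⊕ (Fin nB ⊕ Fin nC)) ℝ)
    (hV : V.PosDef) :
    IM3 V = 0 ↔
      ∃ (H : Matrix (Fin nB ⊕ Fin nC) (Fin nC) ℝ)
        (K : Matrix (Fin nB ⊕ Fin nC) (Fin nB ⊕ Fin nC) ℝ),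
        K.PosSemidef ∧
          (fromBlocks (1 : Matrix (Fin nA) (Fin nA) ℝ) 0 0 H) * V.submatrix eAC eAC *
              (fromBlocks (1 : Matrix (Fin nA) (Fin nA) ℝ) 0 0 H)ᵀ +
            fromBlocks 0 0 0 K = V := by
  obtain ⟨a, X, Y, b, Z, c, rfl⟩ : ∃ (a : Matrix (Fin nA) (Fin nA) ℝ)
      (X : Matrix (Fin nA) (Fin nB) ℝ) (Y : Matrix (Fin nA) (Fin nC) ℝ)
      (b : Matrix (Fin nB) (Fin nB) ℝ) (Z : Matrix (Fin nB) (Fin nC) ℝ)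
      (c : Matrix (Fin nC) (Fin nC) ℝ),
      V = fromBlocks a (fromCols X Y) (fromRows Xᴴ Yᴴ) (fromBlocks b Z Zᴴ c) := by
    refine ⟨V.toBlocks₁₁, V.toBlocks₁₂.toCols₁, V.toBlocks₁₂.toCols₂, V.toBlocks₂₂.toBlocks₁₁,
      V.toBlocks₂₂.toBlocks₁₂, V.toBlocks₂₂.toBlocks₂₂, ?_⟩
    ext (i | i | i) (j | j | j) <;> first | rfl | exact (hV.isHermitian.apply _ _).symm
  rw [IM3_fromBlocks_eq_zero_iff hV, fromBlocks_submatrix_eAC]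
  exact (exists_gaussian_channel_iff hV).symm
end

section
/- Let V_A be an n_A×n_A real positive definite matrix, let V_BC = [[B, Z],[Zᵀ, C]] be a real positive definite matrix on ℝ^{n_B+n_C}, and let σ_AC be any real positive definite matrix on ℝ^{n_A+n_C}. Define H_R as the (n_A+n_B+n_C)×(n_A+n_C) block matrix [[I_{n_A}, 0],[0, Z C⁻¹],[0, I_{n_C}]] and K_R := 0_{n_A} ⊕ (B − Z C⁻¹ Zᵀ) ⊕ 0_{n_C}. Then ( V_A⁻¹ ⊕ V_BC⁻¹ + ι (σ_AC⁻¹ − V_A⁻¹ ⊕ C⁻¹) ιᵀ ) · ( H_R σ_AC H_Rᵀ + K_R ) = I, where ι is the canonical embedding of the A and C coordinates into the A, B, C coordinates (padding the B rows and columns with zeros). In other words, the Gaussian Petz recovery map for discarding B from the reference state with covariance V_A ⊕ V_BC acts on covariance matrices as σ_AC ↦ H_R σ_AC H_Rᵀ + K_R. -/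
open Matrix

/-- Abstract form of the Petz recovery identity: if `Sᵀ H = 1`,
`P⁻¹ H = S Q⁻¹` and `P = H Q Hᵀ + K` with `Sᵀ K = 0`, then `H σ Hᵀ + K` inverts
`P⁻¹ + S (σ⁻¹ - Q⁻¹) Sᵀ`. -/
theorem Matrix.inv_add_mul_sub_mul_transpose_mul_eq_one
    {m n R : Type*} [Fintype m] [DecidableEq m] [Fintype n] [DecidableEq n] [CommRing R]
    {P P' K : Matrix m m R} {Q Q' σ σ' : Matrix n n R} {S H : Matrix m n R}
    (hP : P' * P = 1) (hQ : Q' * Q = 1) (hσ : σ' * σ = 1)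
    (hPH : P' * H = S * Q') (hSH : Sᵀ * H = 1) (hSK : Sᵀ * K = 0)
    (hK : P = H * Q * Hᵀ + K) :
    (P' + S * (σ' - Q') * Sᵀ) * (H * σ * Hᵀ + K) = 1 := by
  have hPK : P' * K = 1 - S * Hᵀ := by
    rw [← hP, hK, Matrix.mul_add, ← Matrix.mul_assoc P', ← Matrix.mul_assoc P', hPH,
      Matrix.mul_assoc S, hQ, Matrix.mul_one, add_sub_cancel_left]
  have hS : Sᵀ * (H * σ * Hᵀ + K) = σ * Hᵀ := by
    rw [Matrix.mul_add, hSK, add_zero, ← Matrix.mul_assoc, ← Matrix.mul_assoc, hSH, Matrix.one_mul]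
  have hPP : P' * (H * σ * Hᵀ + K) = S * Q' * σ * Hᵀ + (1 - S * Hᵀ) := by
    rw [Matrix.mul_add, hPK, ← Matrix.mul_assoc, ← Matrix.mul_assoc, hPH]
  rw [Matrix.add_mul, hPP, Matrix.mul_assoc (S * (σ' - Q')), hS, ← Matrix.mul_assoc,
    Matrix.mul_assoc S (σ' - Q'), Matrix.sub_mul, hσ, Matrix.mul_sub, Matrix.mul_one,
    Matrix.sub_mul, ← Matrix.mul_assoc S]
  abel

/-- the Gaussian Petz recovery map for discarding `B` from the reference
state with covariance `V_A ⊕ V_BC` acts on covariance matrices as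
`σ_AC ↦ H_R σ_AC H_Rᵀ + K_R`; i.e. the latter matrix is the inverse of
`V_A⁻¹ ⊕ V_BC⁻¹ + ι (σ_AC⁻¹ − V_A⁻¹ ⊕ C⁻¹) ιᵀ`. -/
theorem stmt7 {nA nB nC : ℕ}
    (VA : Matrix (Fin nA) (Fin nA) ℝ)
    (B : Matrix (Fin nB) (Fin nB) ℝ) (C : Matrix (Fin nC) (Fin nC) ℝ)
    (Z : Matrix (Fin nB) (Fin nC) ℝ)
    (VBC : Matrix (Fin nB ⊕ Fin nC) (Fin nB ⊕ Fin nC) ℝ)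
    (hVBCdef : VBC = fromBlocks B Z Zᵀ C)
    (σ : Matrix (Fin nA ⊕ Fin nC) (Fin nA ⊕ Fin nC) ℝ)
    (hVA : VA.PosDef) (hVBC : VBC.PosDef) (hσ : σ.PosDef)
    -- the canonical embedding of the `AC` coordinates into the `ABC` coordinates
    (ι : Matrix (Fin nA ⊕ (Fin nB ⊕ Fin nC)) (Fin nA ⊕ Fin nC) ℝ)
    (hι : ι = fromBlocks (1 : Matrix (Fin nA) (Fin nA) ℝ) 0 0
      (fromRows (0 : Matrix (Fin nB) (Fin nC) ℝ) (1 : Matrix (Fin nC) (Fin nC) ℝ)))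
    -- the matrices `H_R` and `K_R` of the Gaussian Petz recovery map
    (HR : Matrix (Fin nA ⊕ (Fin nB ⊕ Fin nC)) (Fin nA ⊕ Fin nC) ℝ)
    (hHR : HR = fromBlocks (1 : Matrix (Fin nA) (Fin nA) ℝ) 0 0
      (fromRows (Z * C⁻¹) (1 : Matrix (Fin nC) (Fin nC) ℝ)))
    (KR : Matrix (Fin nA ⊕ (Fin nB ⊕ Fin nC)) (Fin nA ⊕ (Fin nB ⊕ Fin nC)) ℝ)
    (hKR : KR = fromBlocks 0 0 0 (fromBlocks (B - Z * C⁻¹ * Zᵀ) 0 0 0)) :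
    (fromBlocks VA⁻¹ 0 0 VBC⁻¹ +
        ι * (σ⁻¹ - fromBlocks VA⁻¹ 0 0 C⁻¹) * ιᵀ) *
      (HR * σ * HRᵀ + KR) = 1 := by
  subst hVBCdef hι hHR hKR
  have hC : C.PosDef := hVBC.submatrix Sum.inr_injective
  have hVAu : IsUnit VA.det := (Matrix.isUnit_iff_isUnit_det _).1 hVA.isUnit
  have hCu : IsUnit C.det := (Matrix.isUnit_iff_isUnit_det _).1 hC.isUnit
  have hVu : IsUnit (fromBlocks B Z Zᵀ C).det := (Matrix.isUnit_iff_isUnit_det _).1 hVBC.isUnit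
  have hσu : IsUnit σ.det := (Matrix.isUnit_iff_isUnit_det _).1 hσ.isUnit
  have hCt : Cᵀ = C := by simpa using hC.isHermitian.eq
  have hlift : fromBlocks B Z Zᵀ C *
      (fromRows 0 C⁻¹ : Matrix (Fin nB ⊕ Fin nC) (Fin nC) ℝ) = fromRows (Z * C⁻¹) 1 := by
    simp [fromBlocks_mul_fromRows, Matrix.mul_nonsing_inv _ hCu]
  have hlift' : (fromBlocks B Z Zᵀ C)⁻¹ *
      (fromRows (Z * C⁻¹) 1 : Matrix (Fin nB ⊕ Fin nC) (Fin nC) ℝ) = fromRows 0 C⁻¹ := by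
    rw [← hlift, Matrix.nonsing_inv_mul_cancel_left _ _ hVu]
  refine Matrix.inv_add_mul_sub_mul_transpose_mul_eq_one
    (P := fromBlocks VA 0 0 (fromBlocks B Z Zᵀ C)) (Q := fromBlocks VA 0 0 C)
    ?_ ?_ (Matrix.nonsing_inv_mul _ hσu) ?_ ?_ ?_ ?_
  · simp [fromBlocks_multiply, Matrix.nonsing_inv_mul _ hVAu, Matrix.nonsing_inv_mul _ hVu]
  · simp [fromBlocks_multiply, Matrix.nonsing_inv_mul _ hVAu, Matrix.nonsing_inv_mul _ hCu]
  · simp [fromBlocks_multiply, hlift', fromRows_mul]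
  · simp [fromBlocks_transpose, fromBlocks_multiply, transpose_fromRows, fromCols_mul_fromRows]
  · simp [fromBlocks_transpose, fromBlocks_multiply, transpose_fromRows, fromCols_mul_fromBlocks]
  · simp [fromBlocks_transpose, fromBlocks_multiply, transpose_fromRows, fromRows_mul,
      fromBlocks_add, transpose_nonsing_inv, hCt,
      Matrix.nonsing_inv_mul_cancel_right _ _ hCu, Matrix.mul_nonsing_inv_cancel_left _ _ hCu,
      Matrix.mul_assoc]
end

section
/- Let V_AB = [[A, X],[Xᵀ, B]] be a real positive semidefinite matrix with positive definite diagonal blocks A and B and with det V_AB > 0. Then I_M(A:B)_V ≥ (1/2)·Tr( A⁻¹ X B⁻¹ Xᵀ ) = (1/2)·‖A^{−1/2} X B^{−1/2}‖₂², where ‖·‖₂ denotes the Frobenius (Hilbert–Schmidt) norm. -/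
open Matrix

/-- The squared Frobenius (Hilbert--Schmidt) norm of a real matrix. -/
noncomputable def frobSq {μ ν : Type*} [Fintype μ] [Fintype ν]
    (M : Matrix μ ν ℝ) : ℝ :=
  ∑ i, ∑ j, (M i j) ^ 2

/-- Arbitrary powers of a Hermitian matrix are Hermitian. -/
theorem isHermitian_mpow {N : Type*} [Fintype N] [DecidableEq N] {M : Matrix N N ℝ}
    (hM : M.IsHermitian) (t : ℝ) : (mpow M t).IsHermitian := by
  rw [mpow, dif_pos hM, star_eq_conjTranspose]
  exact isHermitian_mul_mul_conjTranspose _ (isHermitian_diagonal _)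

theorem mpow_neg_half_mul_self {N : Type*} [Fintype N] [DecidableEq N] {M : Matrix N N ℝ}
    (hM : M.PosDef) : mpow M (-(1 / 2)) * mpow M (-(1 / 2)) = M⁻¹ := by
  set U : Matrix N N ℝ := (hM.1.eigenvectorUnitary : Matrix N N ℝ) with hU
  have hUU : star U * U = 1 := Unitary.coe_star_mul_self hM.1.eigenvectorUnitary
  have hUU' : U * star U = 1 := Unitary.coe_mul_star_self hM.1.eigenvectorUnitary
  have hspec : M = U * diagonal hM.1.eigenvalues * star U := by
    simpa [Unitary.conjStarAlgAut_apply, Function.comp_def] using hM.1.spectral_theorem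
  have hcancel (D E : Matrix N N ℝ) :
      (U * D * star U) * (U * E * star U) = U * (D * E) * star U := by
    simp only [Matrix.mul_assoc]
    rw [← Matrix.mul_assoc (star U) U, hUU, Matrix.one_mul]
  symm
  apply inv_eq_left_inv
  rw [mpow, dif_pos hM.1, ← hU]
  conv_lhs => rhs; rw [hspec]
  rw [hcancel, hcancel, diagonal_mul_diagonal, diagonal_mul_diagonal]
  have hone : (fun i => hM.1.eigenvalues i ^ (-(1 / 2) : ℝ) * hM.1.eigenvalues i ^ (-(1 / 2) : ℝ) *
      hM.1.eigenvalues i) = fun _ => 1 := by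
    funext i
    have hi := hM.eigenvalues_pos i
    rw [← Real.rpow_add hi, show (-(1 / 2) + -(1 / 2) : ℝ) = -1 by norm_num,
      Real.rpow_neg_one, inv_mul_cancel₀ hi.ne']
  rw [hone, diagonal_one, Matrix.mul_one, hUU']

theorem frobSq_eq_trace {μ ν : Type*} [Fintype μ] [Fintype ν] (M : Matrix μ ν ℝ) :
    frobSq M = (M * Mᵀ).trace := by
  simp [frobSq, trace, mul_apply, sq]

theorem log_det_le_trace_sub_card {N : Type*} [Fintype N] [DecidableEq N] {M : Matrix N N ℝ}
    (hM : M.PosDef) : Real.log M.det ≤ M.trace - Fintype.card N := by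
  rw [hM.1.det_eq_prod_eigenvalues, hM.1.trace_eq_sum_eigenvalues]
  simp only [RCLike.ofReal_real_eq_id, id_eq]
  rw [Real.log_prod fun i _ => (hM.eigenvalues_pos i).ne']
  calc ∑ i, Real.log (hM.1.eigenvalues i) ≤ ∑ i, (hM.1.eigenvalues i - 1) :=
        Finset.sum_le_sum fun i _ => Real.log_le_sub_one_of_pos (hM.eigenvalues_pos i)
    _ = _ := by simp [Finset.sum_sub_distrib]

/-- `I_M(A:B)_V ≥ (1/2)·Tr(A⁻¹ X B⁻¹ Xᵀ) = (1/2)·‖A^{−1/2} X B^{−1/2}‖₂²`. -/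
theorem stmt9 {nA nB : ℕ}
    (A : Matrix (Fin nA) (Fin nA) ℝ) (B : Matrix (Fin nB) (Fin nB) ℝ)
    (X : Matrix (Fin nA) (Fin nB) ℝ)
    (V : Matrix (Fin nA ⊕ Fin nB) (Fin nA ⊕ Fin nB) ℝ)
    (hVdef : V = fromBlocks A X Xᵀ B)
    (hV : V.PosSemidef) (hA : A.PosDef) (hB : B.PosDef) (hdet : 0 < V.det) :
    IM2 V ≥ (1 / 2) * (A⁻¹ * X * B⁻¹ * Xᵀ).trace ∧
      (1 / 2) * (A⁻¹ * X * B⁻¹ * Xᵀ).trace =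
        (1 / 2) * frobSq (mpow A (-(1 / 2)) * X * mpow B (-(1 / 2))) := by
  have hQ := mpow_neg_half_mul_self hA
  have hR := mpow_neg_half_mul_self hB
  have hQt : (mpow A (-(1 / 2)))ᵀ = mpow A (-(1 / 2)) := isHermitian_mpow hA.1 _
  have hRt : (mpow B (-(1 / 2)))ᵀ = mpow B (-(1 / 2)) := isHermitian_mpow hB.1 _
  generalize mpow A (-(1 / 2)) = Q at *
  generalize mpow B (-(1 / 2)) = R at *
  have htrace : (Q * (X * B⁻¹ * Xᵀ) * Q).trace = (A⁻¹ * X * B⁻¹ * Xᵀ).trace := by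
    rw [trace_mul_comm, ← Matrix.mul_assoc, hQ]
    simp only [Matrix.mul_assoc]
  refine ⟨?_, ?_⟩
  · have hAu : IsUnit A.det := hA.det_pos.ne'.isUnit
    let : Invertible B := invertibleOfIsUnitDet B hB.det_pos.ne'.isUnit
    have hQAQ : Q * A * Q = 1 := by
      rw [mul_eq_one_comm, ← Matrix.mul_assoc, hQ, nonsing_inv_mul _ hAu]
    have hVdet : V.det = B.det * (A - X * B⁻¹ * Xᵀ).det := by
      rw [hVdef, det_fromBlocks₂₂, invOf_eq_nonsing_inv]
    have hS : (A - X * B⁻¹ * Xᵀ).PosSemidef := by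
      rw [hVdef] at hV
      simpa using (hB.fromBlocks₂₂ A X).1 (by simpa using hV)
    set S := A - X * B⁻¹ * Xᵀ with hSdef
    have hSdet : 0 < S.det := by
      rw [hVdet] at hdet
      exact pos_of_mul_pos_right hdet hB.det_pos.le
    have hTdet : (Q * S * Q).det = S.det / A.det := by
      have := congrArg det hQAQ
      simp only [det_mul, det_one] at this ⊢
      rw [eq_div_iff hA.det_pos.ne']
      linear_combination S.det * this
    have hT : (Q * S * Q).PosDef := by
      have hpsd : (Q * S * Q).PosSemidef := by
        have h := hS.mul_mul_conjTranspose_same Q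
        rwa [conjTranspose_eq_transpose_of_trivial, hQt] at h
      rw [hpsd.posDef_iff_det_ne_zero, hTdet]
      exact (div_pos hSdet hA.det_pos).ne'
    have hlog := log_det_le_trace_sub_card hT
    rw [hTdet, hSdef, Matrix.mul_sub, Matrix.sub_mul, hQAQ, trace_sub, htrace, trace_one,
      ← hSdef] at hlog
    have hratio : A.det * B.det / V.det = (S.det / A.det)⁻¹ := by
      rw [hVdet, inv_div, mul_comm A.det, mul_div_mul_left _ _ hB.det_pos.ne']
    have hI : IM2 V = 1 / 2 * -Real.log (S.det / A.det) := by
      rw [← Real.log_inv, ← hratio, IM2]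
      simp [hVdef]
    rw [hI]
    linarith
  · rw [← htrace, ← hR, frobSq_eq_trace]
    simp only [transpose_mul, hQt, hRt, Matrix.mul_assoc]
end

section
/- (Williamson's decomposition.) Let K be a 2n×2n real positive definite matrix. Then there exist a symplectic matrix S and an n×n diagonal matrix D with strictly positive diagonal entries such that K = S · [[D, 0],[0, D]] · Sᵀ. -/
open Matrix

/-- The standard symplectic form on `n` modes. -/
def Omg (n : ℕ) : Matrix (Fin n ⊕ Fin n) (Fin n ⊕ Fin n) ℝ :=
  fromBlocks 0 1 (-1) 0

/-- A real matrix is symplectic (with respect to a given form `Ω`) if `S Ω Sᵀ = Ω`. -/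
def IsSymplectic {N : Type*} [Fintype N] (Ω S : Matrix N N ℝ) : Prop :=
  S * Ω * Sᵀ = Ω

/-- A nonzero subspace invariant under an injective skew-adjoint operator contains an
orthonormal pair spanning an invariant plane. -/
theorem exists_orthonormal_pair_of_skew {E : Type*} [NormedAddCommGroup E]
    [InnerProductSpace ℝ E] [FiniteDimensional ℝ E] {T : E →ₗ[ℝ] E}
    (hskew : ∀ x y, inner ℝ (T x) y = -inner ℝ x (T y)) (hinj : ∀ x, T x = 0 → x = 0)
    (W : Submodule ℝ E) (hW : W ≠ ⊥) (hTW : ∀ x ∈ W, T x ∈ W) :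
    ∃ v ∈ W, ∃ w ∈ W, ∃ l : ℝ, 0 < l ∧ T v = l • w ∧ T w = -(l • v) ∧
      ‖v‖ = 1 ∧ ‖w‖ = 1 ∧ inner ℝ v w = 0 := by
  have : Nontrivial W := Submodule.nontrivial_iff_ne_bot.mpr hW
  have hinv : ∀ x ∈ W, (T ∘ₗ T) x ∈ W := fun x hx => hTW _ (hTW _ hx)
  have hsym : ((T ∘ₗ T).restrict hinv).IsSymmetric := by
    intro x y
    simp [Submodule.coe_inner, hskew]
  obtain ⟨x, hx⟩ := hsym.hasEigenvalue_iSup_of_finiteDimensional.exists_hasEigenvector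
  generalize (⨆ x : { x : W // x ≠ 0 }, _ : ℝ) = μ at hx
  have hx0 : (x : E) ≠ 0 := by simpa using hx.2
  have hTTx : T (T x) = μ • (x : E) := by
    simpa [LinearMap.coe_restrict_apply] using congrArg Subtype.val hx.apply_eq_smul
  set v : E := ‖(x : E)‖⁻¹ • (x : E) with hv
  have hvW : v ∈ W := W.smul_mem _ x.2
  have hvv : ‖v‖ = 1 := norm_smul_inv_norm (𝕜 := ℝ) hx0
  have hTTv : T (T v) = μ • v := by
    rw [hv, map_smul, map_smul, hTTx, smul_comm]
  have hTv : T v ≠ 0 := fun h => by simp [hinj v h] at hvv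
  have hl : 0 < ‖T v‖ := norm_pos_iff.mpr hTv
  have hμ : μ = -‖T v‖ ^ 2 := by
    have h := hskew (T v) v
    rw [hTTv, real_inner_smul_left, real_inner_self_eq_norm_sq, hvv, real_inner_self_eq_norm_sq] at h
    linarith
  have hvTv : inner ℝ v (T v) = 0 := by
    have h := hskew v v
    rw [real_inner_comm] at h
    linarith
  refine ⟨v, hvW, ‖T v‖⁻¹ • T v, W.smul_mem _ (hTW _ hvW), ‖T v‖, hl, ?_, ?_, hvv, ?_, ?_⟩
  · rw [smul_inv_smul₀ hl.ne']
  · rw [map_smul, hTTv, hμ, smul_smul, ← neg_smul]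
    congr 1
    field_simp
  · exact norm_smul_inv_norm (𝕜 := ℝ) hTv
  · rw [real_inner_smul_right, hvTv, mul_zero]

/-- An injective skew-adjoint operator on a space of dimension at least `2 * k` has `k` mutually
orthogonal invariant planes, each with an adapted orthonormal basis. -/
theorem exists_orthonormal_family_of_skew {E : Type*} [NormedAddCommGroup E]
    [InnerProductSpace ℝ E] [FiniteDimensional ℝ E] {T : E →ₗ[ℝ] E}
    (hskew : ∀ x y, inner ℝ (T x) y = -inner ℝ x (T y)) (hinj : ∀ x, T x = 0 → x = 0)
    (k : ℕ) (hk : 2 * k ≤ Module.finrank ℝ E) :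
    ∃ (e f : Fin k → E) (l : Fin k → ℝ), (∀ i, 0 < l i) ∧
      (∀ i, T (e i) = l i • f i) ∧ (∀ i, T (f i) = -(l i • e i)) ∧
      (∀ i j, inner ℝ (e i) (e j) = if i = j then (1 : ℝ) else 0) ∧
      (∀ i j, inner ℝ (f i) (f j) = if i = j then (1 : ℝ) else 0) ∧
      (∀ i j, inner ℝ (e i) (f j) = (0 : ℝ)) := by
  induction k with
  | zero => exact ⟨Fin.elim0, Fin.elim0, Fin.elim0, by simp⟩
  | succ k ih =>
    obtain ⟨e, f, l, hl, hTe, hTf, hee, hff, hef⟩ := ih (by omega)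
    set V := Submodule.span ℝ (Set.range (Sum.elim e f)) with hV
    have hVrank : Module.finrank ℝ V ≤ 2 * k := by
      refine (finrank_range_le_card (R := ℝ) (Sum.elim e f)).trans ?_
      simp [two_mul]
    have hmem : ∀ x, x ∈ Vᗮ ↔ ∀ i, inner ℝ (e i) x = 0 ∧ inner ℝ (f i) x = 0 := by
      intro x
      rw [hV, ← Submodule.span_singleton_le_iff_mem, Submodule.le_orthogonal_iff_le_orthogonal,
        Submodule.span_le]
      simp [Set.range_subset_iff, Submodule.mem_orthogonal_singleton_iff_inner_left, forall_and]
    have hW : Vᗮ ≠ ⊥ := by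
      intro h
      have := V.finrank_add_finrank_orthogonal
      rw [h, finrank_bot] at this
      omega
    have hTW : ∀ x ∈ Vᗮ, T x ∈ Vᗮ := by
      intro x hx
      rw [hmem] at hx ⊢
      intro i
      have h₁ := hskew (e i) x
      have h₂ := hskew (f i) x
      rw [hTe, real_inner_smul_left, (hx i).2] at h₁
      rw [hTf, inner_neg_left, real_inner_smul_left, (hx i).1] at h₂
      constructor <;> linarith
    obtain ⟨v, hv, w, hw, m, hm, hTv, hTw, hvv, hww, hvw⟩ :=
      exists_orthonormal_pair_of_skew hskew hinj Vᗮ hW hTW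
    rw [hmem] at hv hw
    have hv₁ := fun i => (real_inner_comm _ _).trans (hv i).1
    have hv₂ := fun i => (real_inner_comm _ _).trans (hv i).2
    have hw₂ := fun i => (real_inner_comm _ _).trans (hw i).2
    refine ⟨Fin.cons v e, Fin.cons w f, Fin.cons m l, ?_, ?_, ?_, ?_, ?_, ?_⟩
    · exact Fin.cases hm hl
    · exact Fin.cases hTv hTe
    · exact Fin.cases hTw hTf
    · refine Fin.cases (Fin.cases ?_ ?_) fun i => Fin.cases ?_ ?_ <;>
        simp [hvv, hv, hv₁, hee, Fin.succ_ne_zero, (Fin.succ_ne_zero _).symm]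
    · refine Fin.cases (Fin.cases ?_ ?_) fun i => Fin.cases ?_ ?_ <;>
        simp [hww, hw, hw₂, hff, Fin.succ_ne_zero, (Fin.succ_ne_zero _).symm]
    · refine Fin.cases (Fin.cases ?_ ?_) fun i => Fin.cases ?_ ?_ <;>
        simp [hvw, hv₂, hw, hef]

/-- Orthogonal normal form of an invertible real skew-symmetric matrix. -/
theorem exists_orthogonal_normal_form_of_skew {n : ℕ}
    (A : Matrix (Fin n ⊕ Fin n) (Fin n ⊕ Fin n) ℝ) (hA : Aᵀ = -A) (hdet : IsUnit A.det) :
    ∃ (O : Matrix (Fin n ⊕ Fin n) (Fin n ⊕ Fin n) ℝ) (l : Fin n → ℝ),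
      O * Oᵀ = 1 ∧ (∀ i, 0 < l i) ∧
        A * O = O * fromBlocks 0 (diagonal l) (-diagonal l) 0 := by
  have hskew : ∀ x y, inner ℝ (A.toEuclideanLin x) y = -inner ℝ x (A.toEuclideanLin y) := by
    intro x y
    have h := dotProduct_mulVec y.ofLp A x.ofLp
    rw [← mulVec_transpose, hA, neg_mulVec, neg_dotProduct] at h
    simp only [EuclideanSpace.inner_eq_star_dotProduct, toLpLin_apply, star_trivial]
    exact h
  have hinj : ∀ x, A.toEuclideanLin x = 0 → x = 0 := by
    intro x hx
    have h : A *ᵥ x.ofLp = 0 := by simpa [toLpLin_apply] using hx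
    have := mulVec_injective_of_isUnit ((isUnit_iff_isUnit_det A).mpr hdet)
      (h.trans (mulVec_zero A).symm)
    ext i
    exact congrFun this i
  obtain ⟨e, f, l, hl, hTe, hTf, hee, hff, hef⟩ :=
    exists_orthonormal_family_of_skew hskew hinj n (by simp [two_mul])
  have hfe : ∀ i j, inner ℝ (f i) (e j) = (0 : ℝ) :=
    fun i j => (real_inner_comm _ _).trans (hef j i)
  refine ⟨of fun i j => Sum.elim f e j i, l, ?_, hl, ?_⟩
  · rw [mul_eq_one_comm]
    have hO : ∀ i j, ((of fun i j => Sum.elim f e j i)ᵀ * of fun i j => Sum.elim f e j i :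
        Matrix (Fin n ⊕ Fin n) (Fin n ⊕ Fin n) ℝ) i j =
        inner ℝ (Sum.elim f e i) (Sum.elim f e j) := by
      intro i j
      simp only [EuclideanSpace.inner_eq_star_dotProduct, star_trivial, mul_apply,
        transpose_apply, of_apply, dotProduct, mul_comm]
    ext (i | i) (j | j) <;> rw [hO] <;> simp [hee, hff, hef, hfe, one_apply]
  · ext a (j | j)
    · have h := congrArg (fun x => x.ofLp a) (hTf j)
      simp only [toLpLin_apply, PiLp.neg_apply, PiLp.smul_apply, smul_eq_mul] at h
      simpa [mul_apply, diagonal_apply, mulVec, dotProduct, mul_comm] using h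
    · have h := congrArg (fun x => x.ofLp a) (hTe j)
      simp only [toLpLin_apply, PiLp.smul_apply, smul_eq_mul] at h
      simpa [mul_apply, diagonal_apply, mulVec, dotProduct, mul_comm] using h

theorem Omg_transpose (n : ℕ) : (Omg n)ᵀ = -Omg n := by
  simp [Omg, fromBlocks_transpose, fromBlocks_neg]

theorem isUnit_det_Omg (n : ℕ) : IsUnit (Omg n).det := by
  have h : Omg n * -Omg n = 1 := by
    simp [Omg, fromBlocks_neg, fromBlocks_multiply, fromBlocks_one]
  exact isUnit_det_of_right_inverse h

/-- Williamson's decomposition: every `2n×2n` real positive definite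
matrix `K` can be written as `K = S [[D,0],[0,D]] Sᵀ` with `S` symplectic and `D`
diagonal with strictly positive entries. -/
theorem stmt12 {n : ℕ} (K : Matrix (Fin n ⊕ Fin n) (Fin n ⊕ Fin n) ℝ)
    (hK : K.PosDef) :
    ∃ (S : Matrix (Fin n ⊕ Fin n) (Fin n ⊕ Fin n) ℝ) (d : Fin n → ℝ),
      IsSymplectic (Omg n) S ∧ (∀ i, 0 < d i) ∧
        K = S * fromBlocks (Matrix.diagonal d) 0 0 (Matrix.diagonal d) * Sᵀ := by
  obtain ⟨B, hKB⟩ : ∃ B : Matrix (Fin n ⊕ Fin n) (Fin n ⊕ Fin n) ℝ, K = B * Bᵀ := by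
    open scoped MatrixOrder in
    obtain ⟨C, hC⟩ := CStarAlgebra.nonneg_iff_eq_star_mul_self.mp hK.posSemidef.nonneg
    exact ⟨Cᵀ, by simpa [star_eq_conjTranspose] using hC⟩
  have hB : IsUnit B.det := by
    have h := hK.det_pos.ne'
    rw [hKB, det_mul] at h
    exact (left_ne_zero_of_mul h).isUnit
  have hBt : IsUnit Bᵀ.det := by rwa [det_transpose]
  set A := B⁻¹ * Omg n * (Bᵀ)⁻¹ with hA
  have hAt : Aᵀ = -A := by
    simp only [hA, transpose_mul, transpose_nonsing_inv, transpose_transpose, Omg_transpose,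
      Matrix.mul_assoc, Matrix.neg_mul, Matrix.mul_neg]
  have hAdet : IsUnit A.det := by
    rw [hA, det_mul, det_mul]
    exact ((isUnit_nonsing_inv_det B hB).mul (isUnit_det_Omg n)).mul
      (isUnit_nonsing_inv_det Bᵀ hBt)
  have hBA : B * A * Bᵀ = Omg n := by
    rw [hA, Matrix.mul_assoc, Matrix.mul_assoc (B⁻¹ * Omg n), nonsing_inv_mul _ hBt,
      Matrix.mul_one, mul_nonsing_inv_cancel_left _ _ hB]
  obtain ⟨O, l, hO, hl, hAO⟩ := exists_orthogonal_normal_form_of_skew A hAt hAdet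
  set G : Matrix (Fin n ⊕ Fin n) (Fin n ⊕ Fin n) ℝ :=
    fromBlocks (diagonal fun i => √(l i)) 0 0 (diagonal fun i => √(l i)) with hG
  have hsqrt : ∀ i, √(l i) * √(l i) = l i := fun i => Real.mul_self_sqrt (hl i).le
  have hGt : Gᵀ = G := by simp [hG]
  have hGΩ : G * Omg n * G = fromBlocks 0 (diagonal l) (-diagonal l) 0 := by
    simp [-fromBlocks_diagonal, hG, Omg, fromBlocks_multiply, hsqrt]
  have hGD : G * fromBlocks (diagonal fun i => (l i)⁻¹) 0 0 (diagonal fun i => (l i)⁻¹) * G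
      = 1 := by
    have h : ∀ i, √(l i) * (l i)⁻¹ * √(l i) = 1 := fun i => by
      rw [mul_right_comm, hsqrt, mul_inv_cancel₀ (hl i).ne']
    simp [-fromBlocks_diagonal, hG, fromBlocks_multiply, h]
  refine ⟨B * O * G, fun i => (l i)⁻¹, ?_, fun i => inv_pos.mpr (hl i), ?_⟩
  · calc B * O * G * Omg n * (B * O * G)ᵀ = B * (O * (G * Omg n * G)) * Oᵀ * Bᵀ := by
          simp only [transpose_mul, hGt, Matrix.mul_assoc]
      _ = B * A * (O * Oᵀ) * Bᵀ := by rw [hGΩ, ← hAO]; simp only [Matrix.mul_assoc]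
      _ = Omg n := by rw [hO, Matrix.mul_one, hBA]
  · calc K = B * (O * Oᵀ) * Bᵀ := by rw [hO, Matrix.mul_one, hKB]
      _ = B * O * (G * fromBlocks (diagonal fun i => (l i)⁻¹) 0 0
            (diagonal fun i => (l i)⁻¹) * G) * Oᵀ * Bᵀ := by
          rw [hGD, Matrix.mul_one]; simp only [Matrix.mul_assoc]
      _ = _ := by simp only [transpose_mul, hGt, Matrix.mul_assoc]
end

section
/- Let V_AB be a quantum covariance matrix on n_A + n_B modes, with block structure V_AB = [[V_A, X],[Xᵀ, V_B]] relative to the partition of the phase-space coordinates into those of subsystem A and those of subsystem B (so that Ω_{AB} = Ω_{n_A} ⊕ Ω_{n_B}). If the reduced matrix V_A is a pure quantum covariance matrix, then X = 0, i.e. V_AB = V_A ⊕ V_B. -/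
open Matrix
open scoped ComplexOrder

/-- Complexification of a real matrix. -/
noncomputable def cplx {μ ν : Type*} (M : Matrix μ ν ℝ) : Matrix μ ν ℂ :=
  M.map (fun x => (x : ℂ))

/-- A quantum covariance matrix with respect to a symplectic form `Ω`: a real symmetric
matrix `V` with `V + iΩ ≥ 0`. -/
def IsQCM {N : Type*} [Fintype N] [DecidableEq N] (Ω V : Matrix N N ℝ) : Prop :=
  V.IsSymm ∧ (cplx V + Complex.I • cplx Ω).PosSemidef

/-- A pure quantum covariance matrix: `V = S Sᵀ` with `S` symplectic. -/
def IsPureQCM {N : Type*} [Fintype N] (Ω V : Matrix N N ℝ) : Prop :=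
  ∃ S, IsSymplectic Ω S ∧ V = S * Sᵀ

theorem cplx_mul {l m n : Type*} [Fintype m] (A : Matrix l m ℝ) (B : Matrix m n ℝ) :
    cplx (A * B) = cplx A * cplx B :=
  Matrix.map_mul (f := Complex.ofRealHom)

theorem Omg_mul_self (n : ℕ) : Omg n * Omg n = -1 := by
  simp [Omg, fromBlocks_multiply, ← fromBlocks_one, fromBlocks_neg]

theorem eq_zero_of_cplx_sub_I_smul {m n : Type*} {A B : Matrix m n ℝ}
    (h : cplx A - Complex.I • cplx B = 0) : A = 0 := by
  ext i j
  simpa [cplx] using congrArg Complex.re (congrFun (congrFun h i) j)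

/-- A right annihilator of the top left block of a positive semidefinite matrix also annihilates
the bottom left block. -/
theorem Matrix.PosSemidef.toBlocks₂₁_mul_eq_zero {m n k : Type*} [Fintype m] [Fintype n]
    [Fintype k] {P : Matrix (m ⊕ n) (m ⊕ n) ℂ}
    (hP : P.PosSemidef) {Y : Matrix m k ℂ} (h : P.toBlocks₁₁ * Y = 0) :
    P.toBlocks₂₁ * Y = 0 := by
  classical
  refine ext_of_mulVec_single fun j => ?_
  set u : k → ℂ := Pi.single j 1
  have key : P *ᵥ Sum.elim (Y *ᵥ u) 0 = Sum.elim (0 : m → ℂ) (P.toBlocks₂₁ *ᵥ (Y *ᵥ u)) := by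
    conv_lhs => rw [← fromBlocks_toBlocks P]
    rw [fromBlocks_mulVec]
    simp [mulVec_mulVec, h]
  have hz := (hP.dotProduct_mulVec_zero_iff (Sum.elim (Y *ᵥ u) 0)).1
    (by rw [key]; simp [dotProduct])
  rw [key] at hz
  rw [← mulVec_mulVec, zero_mulVec]
  funext i
  exact congrFun hz (Sum.inr i)

/-- A symplectic matrix for the standard form has an invertible transpose. -/
theorem IsSymplectic.exists_transpose_inv {n : ℕ} {S : Matrix (Fin n ⊕ Fin n) (Fin n ⊕ Fin n) ℝ}
    (hS : IsSymplectic (Omg n) S) : ∃ T, Sᵀ * T = 1 ∧ T * Sᵀ = 1 := by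
  have h : S * (-(Omg n * Sᵀ * Omg n)) = 1 := by
    rw [mul_neg, ← mul_assoc, ← mul_assoc, hS, Omg_mul_self, neg_neg]
  refine ⟨(-(Omg n * Sᵀ * Omg n))ᵀ, ?_, ?_⟩
  · rw [← transpose_mul, mul_eq_one_comm.1 h, transpose_one]
  · rw [← transpose_mul, h, transpose_one]

/-- if the reduction `V_A` of a bipartite QCM `V_AB` is a pure QCM, then
the off-diagonal block vanishes, i.e. `V_AB = V_A ⊕ V_B`. -/
theorem stmt13 {nA nB : ℕ}
    (V : Matrix ((Fin nA ⊕ Fin nA) ⊕ (Fin nB ⊕ Fin nB))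
      ((Fin nA ⊕ Fin nA) ⊕ (Fin nB ⊕ Fin nB)) ℝ)
    (hV : IsQCM (fromBlocks (Omg nA) 0 0 (Omg nB)) V)
    (hVA : IsPureQCM (Omg nA) V.toBlocks₁₁) :
    V.toBlocks₁₂ = 0 ∧ V = fromBlocks V.toBlocks₁₁ 0 0 V.toBlocks₂₂ := by
  obtain ⟨hsymm, hpsd⟩ := hV
  obtain ⟨S, hS, hA⟩ := hVA
  obtain ⟨T, hST, hTS⟩ := hS.exists_transpose_inv
  have h21 : V.toBlocks₂₁ = V.toBlocks₁₂ᵀ := by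
    ext i j
    exact hsymm.apply (Sum.inl j) (Sum.inr i)
  have b11 : (cplx V + Complex.I • cplx (fromBlocks (Omg nA) 0 0 (Omg nB))).toBlocks₁₁
      = cplx V.toBlocks₁₁ + Complex.I • cplx (Omg nA) := by
    ext i j
    simp [cplx, toBlocks₁₁]
  have b21 : (cplx V + Complex.I • cplx (fromBlocks (Omg nA) 0 0 (Omg nB))).toBlocks₂₁
      = cplx V.toBlocks₂₁ := by
    ext i j
    simp [cplx, toBlocks₂₁]
  have hVT : V.toBlocks₁₁ * T = S := by rw [hA, mul_assoc, hST, mul_one]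
  have hOT : Omg nA * T = S * Omg nA := by
    conv_lhs => rw [← show S * Omg nA * Sᵀ = Omg nA from hS]
    rw [mul_assoc, hST, mul_one]
  have hker : (cplx V.toBlocks₁₁ + Complex.I • cplx (Omg nA)) *
      (cplx T - Complex.I • cplx (T * Omg nA)) = 0 := by
    have hc : cplx (S * Omg nA * Omg nA) = -cplx S := by
      rw [mul_assoc, Omg_mul_self]
      ext i j
      simp [cplx]
    rw [add_mul, mul_sub, mul_sub, smul_mul_assoc, smul_mul_assoc, mul_smul_comm, mul_smul_comm,
      ← cplx_mul, ← cplx_mul, ← cplx_mul, ← cplx_mul, ← mul_assoc, ← mul_assoc, hVT, hOT, hc,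
      smul_smul, Complex.I_mul_I]
    simp
  have hoff := hpsd.toBlocks₂₁_mul_eq_zero (by rw [b11]; exact hker)
  rw [b21, Matrix.mul_sub, Matrix.mul_smul, ← cplx_mul, ← cplx_mul] at hoff
  have hT := eq_zero_of_cplx_sub_I_smul hoff
  have h21z : V.toBlocks₂₁ = 0 := by
    rw [← Matrix.mul_one V.toBlocks₂₁, ← hTS, ← Matrix.mul_assoc, hT, Matrix.zero_mul]
  have h12z : V.toBlocks₁₂ = 0 := transpose_eq_zero.1 (h21 ▸ h21z)
  refine ⟨h12z, ?_⟩
  conv_lhs => rw [← fromBlocks_toBlocks V, h12z, h21z]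
end

section
/- Let V_ABC be a quantum covariance matrix on n_A + n_B + n_C modes (relative to the partition of the phase-space coordinates into subsystems A, B, C). Then (1/2)·I_M(A:B|C)_V ≥ E^G_{F,2}(A:B)_{V_AB}, where V_AB is the principal submatrix of V_ABC on the A and B coordinates. Equivalently, there exists a pure quantum covariance matrix γ_AB on n_A + n_B modes with γ_AB ≤ V_AB (Löwner order) and I_M(A:B)_{γ} ≤ I_M(A:B|C)_V. -/
open Matrix
open scoped ComplexOrder

/-- The Gaussian Rényi-2 entanglement of formation of a bipartite QCM `V`, with respect
to the bipartite symplectic form `Ω`. -/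
noncomputable def EF2 {α β : Type*} [Fintype α] [Fintype β] [DecidableEq α] [DecidableEq β]
    (Ω V : Matrix (α ⊕ β) (α ⊕ β) ℝ) : ℝ :=
  sInf {x | ∃ γ : Matrix (α ⊕ β) (α ⊕ β) ℝ,
    IsPureQCM Ω γ ∧ (V - γ).PosSemidef ∧ x = (1 / 2) * IM2 γ}


section PosDefMatrices

open scoped MatrixOrder

variable {N : Type*} [Fintype N] [DecidableEq N]

/-- A positive definite square root, commuting with everything that commutes with the matrix. -/
theorem Matrix.PosDef.exists_sqrt {A : Matrix N N ℝ} (hA : A.PosDef) :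
    ∃ R : Matrix N N ℝ, R.PosDef ∧ R * R = A ∧ ∀ B, Commute A B → Commute R B := by
  have h0 : (0 : Matrix N N ℝ) ≤ A := hA.posSemidef.nonneg
  have hmul : CFC.sqrt A * CFC.sqrt A = A := CFC.sqrt_mul_sqrt_self A
  refine ⟨CFC.sqrt A, ?_, hmul, fun B hB => ?_⟩
  · rw [(CFC.sqrt_nonneg A).posSemidef.posDef_iff_det_ne_zero]
    intro h
    have := hA.det_pos
    rw [← hmul, det_mul, h] at this
    simp at this
  · rw [CFC.sqrt_eq_cfc]
    exact hB.cfc_nnreal _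

theorem Matrix.PosSemidef.eq_of_mul_self_eq {A B : Matrix N N ℝ} (hA : A.PosSemidef)
    (hB : B.PosSemidef) (h : A * A = B * B) : A = B :=
  (CFC.mul_self_eq_mul_self_iff A B hA.nonneg hB.nonneg).1 h

theorem Matrix.PosSemidef.one_le_det_one_add {F : Matrix N N ℝ} (hF : F.PosSemidef) :
    1 ≤ (1 + F).det := by
  have hG : (1 + F).IsHermitian := (PosSemidef.one.add hF).isHermitian
  rw [hG.det_eq_prod_eigenvalues]
  refine Finset.one_le_prod fun i => ?_
  have hv := hG.eigenvalues_eq i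
  have hn : star ⇑(hG.eigenvectorBasis i) ⬝ᵥ ⇑(hG.eigenvectorBasis i) = 1 := by
    have := hG.eigenvectorBasis.orthonormal.1 i
    have h2 := real_inner_self_eq_norm_sq (hG.eigenvectorBasis i)
    rw [this, EuclideanSpace.inner_eq_star_dotProduct] at h2
    simpa [dotProduct_comm] using h2
  rw [add_mulVec, one_mulVec, dotProduct_add, hn] at hv
  have := hF.dotProduct_mulVec_nonneg (hG.eigenvectorBasis i)
  simp only [RCLike.re_to_real, RCLike.ofReal_real_eq_id, id] at hv ⊢
  rw [hv]
  exact fun _ => le_add_of_nonneg_right this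

theorem Matrix.PosDef.det_le_det {A B : Matrix N N ℝ} (hA : A.PosDef)
    (hAB : (B - A).PosSemidef) : A.det ≤ B.det := by
  obtain ⟨R, hR, hRR, -⟩ := hA.exists_sqrt
  have hu : IsUnit R.det := hR.det_pos.ne'.isUnit
  have hF := (hAB.conjTranspose_mul_mul_same R⁻¹).one_le_det_one_add
  rw [hR.inv.isHermitian.eq] at hF
  have hB : B = R * (1 + R⁻¹ * (B - A) * R⁻¹) * R := by
    rw [mul_add, mul_one, add_mul, hRR]
    simp only [← Matrix.mul_assoc, mul_nonsing_inv _ hu, Matrix.one_mul]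
    rw [Matrix.mul_assoc, nonsing_inv_mul _ hu, mul_one]
    abel
  have hdA : A.det = R.det * R.det := by rw [← hRR, det_mul]
  rw [hB, det_mul, det_mul, hdA]
  nlinarith [mul_pos hR.det_pos hR.det_pos]

end PosDefMatrices

section Blocks

variable {m n : Type*}

theorem Matrix.PosDef.toBlocks₁₁ {V : Matrix (m ⊕ n) (m ⊕ n) ℝ} (h : V.PosDef) :
    V.toBlocks₁₁.PosDef := h.submatrix Sum.inl_injective

theorem Matrix.PosDef.toBlocks₂₂ {V : Matrix (m ⊕ n) (m ⊕ n) ℝ} (h : V.PosDef) :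
    V.toBlocks₂₂.PosDef := h.submatrix Sum.inr_injective

theorem Matrix.IsHermitian.toBlocks₁₂_transpose {V : Matrix (m ⊕ n) (m ⊕ n) ℝ}
    (h : V.IsHermitian) : V.toBlocks₁₂ᵀ = V.toBlocks₂₁ := by
  ext i j
  exact h.apply _ _

variable [Fintype m] [Fintype n] [DecidableEq n]

/-- Schur complement of the lower right block. -/
noncomputable def schurCompl (V : Matrix (m ⊕ n) (m ⊕ n) ℝ) : Matrix m m ℝ :=
  V.toBlocks₁₁ - V.toBlocks₁₂ * V.toBlocks₂₂⁻¹ * V.toBlocks₂₁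

theorem toBlocks₁₁_sub_schurCompl_posSemidef {V : Matrix (m ⊕ n) (m ⊕ n) ℝ} (h : V.PosDef) :
    (V.toBlocks₁₁ - schurCompl V).PosSemidef := by
  rw [schurCompl, sub_sub_cancel, ← h.isHermitian.toBlocks₁₂_transpose,
    ← conjTranspose_eq_transpose_of_trivial]
  exact h.toBlocks₂₂.inv.posSemidef.mul_mul_conjTranspose_same _

variable [DecidableEq m]

theorem det_eq_mul_det_schurCompl {V : Matrix (m ⊕ n) (m ⊕ n) ℝ} (h : V.toBlocks₂₂.PosDef) :
    V.det = V.toBlocks₂₂.det * (schurCompl V).det := by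
  let := invertibleOfIsUnitDet _ h.det_pos.ne'.isUnit
  conv_lhs => rw [← fromBlocks_toBlocks V]
  rw [det_fromBlocks₂₂, schurCompl, invOf_eq_nonsing_inv]

/-- The map realising the Schur complement as a compression `Tᵀ V T`. -/
noncomputable def schurMap (V : Matrix (m ⊕ n) (m ⊕ n) ℝ) : Matrix (m ⊕ n) m ℝ :=
  fromRows 1 (-(V.toBlocks₂₂⁻¹ * V.toBlocks₂₁))

theorem schurMap_transpose_mul_mul {V : Matrix (m ⊕ n) (m ⊕ n) ℝ} (h : V.PosDef) :
    (schurMap V)ᵀ * V * schurMap V = schurCompl V := by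
  have hu : IsUnit V.toBlocks₂₂.det := h.toBlocks₂₂.det_pos.ne'.isUnit
  have h1 : V * schurMap V = fromRows (schurCompl V) 0 := by
    conv_lhs => rw [← fromBlocks_toBlocks V]
    rw [schurMap, fromBlocks_toBlocks, ← fromBlocks_toBlocks V, fromBlocks_mul_fromRows,
      fromBlocks_toBlocks]
    simp [schurCompl, ← Matrix.mul_assoc, mul_nonsing_inv _ hu, sub_eq_add_neg]
  rw [Matrix.mul_assoc, h1, schurMap, transpose_fromRows, fromCols_mul_fromRows]
  simp

theorem schurCompl_posDef {V : Matrix (m ⊕ n) (m ⊕ n) ℝ} (h : V.PosDef) :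
    (schurCompl V).PosDef := by
  rw [← schurMap_transpose_mul_mul h, ← conjTranspose_eq_transpose_of_trivial]
  refine h.conjTranspose_mul_mul_same fun x y hxy => ?_
  funext i
  simpa [schurMap, fromRows_mulVec] using congrFun hxy (Sum.inl i)

/-- **Fischer's inequality**. -/
theorem Matrix.PosDef.det_le_mul_det_toBlocks {V : Matrix (m ⊕ n) (m ⊕ n) ℝ} (h : V.PosDef) :
    V.det ≤ V.toBlocks₁₁.det * V.toBlocks₂₂.det := by
  rw [det_eq_mul_det_schurCompl h.toBlocks₂₂, mul_comm]
  exact mul_le_mul_of_nonneg_right ((schurCompl_posDef h).det_le_det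
    (toBlocks₁₁_sub_schurCompl_posSemidef h)) h.toBlocks₂₂.det_pos.le

/-- Jacobi's complementary minor formula for the upper left block. -/
theorem det_mul_det_inv_toBlocks₁₁ {V : Matrix (m ⊕ n) (m ⊕ n) ℝ} (h : V.PosDef) :
    V.det * (V⁻¹).toBlocks₁₁.det = V.toBlocks₂₂.det := by
  let := invertibleOfIsUnitDet _ h.toBlocks₂₂.det_pos.ne'.isUnit
  have hS := schurCompl_posDef h
  have hS' : schurCompl V =
    V.toBlocks₁₁ - V.toBlocks₁₂ * ⅟V.toBlocks₂₂ * V.toBlocks₂₁ := by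
    rw [schurCompl, invOf_eq_nonsing_inv]
  let : Invertible (V.toBlocks₁₁ - V.toBlocks₁₂ * ⅟V.toBlocks₂₂ * V.toBlocks₂₁) :=
    invertibleOfIsUnitDet _ (hS' ▸ hS.det_pos.ne'.isUnit)
  let := fromBlocks₂₂Invertible V.toBlocks₁₁ V.toBlocks₁₂ V.toBlocks₂₁ V.toBlocks₂₂
  have hinv := invOf_fromBlocks₂₂_eq V.toBlocks₁₁ V.toBlocks₁₂ V.toBlocks₂₁ V.toBlocks₂₂
  rw [invOf_eq_nonsing_inv, fromBlocks_toBlocks] at hinv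
  rw [hinv, toBlocks_fromBlocks₁₁, invOf_eq_nonsing_inv, ← hS',
    det_eq_mul_det_schurCompl h.toBlocks₂₂, mul_assoc, ← det_mul,
    mul_nonsing_inv _ hS.det_pos.ne'.isUnit, det_one, mul_one]

/-- Jacobi's complementary minor formula for the lower right block. -/
theorem det_mul_det_inv_toBlocks₂₂ {V : Matrix (m ⊕ n) (m ⊕ n) ℝ} (h : V.PosDef) :
    V.det * (V⁻¹).toBlocks₂₂.det = V.toBlocks₁₁.det := by
  have := det_mul_det_inv_toBlocks₁₁ (h.submatrix (Equiv.sumComm n m).injective)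
  rw [det_submatrix_equiv_self, inv_submatrix_equiv] at this
  exact this

/-- If `[[W, X], [Xᵀ, Y]]` is positive semidefinite then `(det X)² ≤ det W · det Y`. -/
theorem det_sq_le_of_posSemidef_fromBlocks {W X Y : Matrix n n ℝ} (hW : W.PosDef)
    (hX : X.PosDef) (h : (fromBlocks W X X Y).PosSemidef) : X.det ^ 2 ≤ W.det * Y.det := by
  let := invertibleOfIsUnitDet _ hW.det_pos.ne'.isUnit
  have h1 : (Y - X * W⁻¹ * X).PosSemidef := by
    have := (PosDef.fromBlocks₁₁ X Y hW).1 (by rwa [hX.isHermitian.eq])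
    rwa [hX.isHermitian.eq] at this
  have h2 : (X * W⁻¹ * X).PosDef := by
    have := hW.inv.conjTranspose_mul_mul_same (B := X)
      (mulVec_injective_of_isUnit hX.isUnit)
    rwa [hX.isHermitian.eq] at this
  have h3 := h2.det_le_det h1
  have h4 : W.det * (X * W⁻¹ * X).det = X.det ^ 2 := by
    have : W.det * W⁻¹.det = 1 := by
      rw [← det_mul, mul_nonsing_inv _ hW.det_pos.ne'.isUnit, det_one]
    rw [det_mul, det_mul]
    linear_combination X.det ^ 2 * this
  rw [← h4]
  exact mul_le_mul_of_nonneg_left h3 hW.det_pos.le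

end Blocks

section SymplecticForms

variable {N : Type*} [Fintype N] [DecidableEq N]

/-- A real orthogonal complex structure, such as the standard symplectic form. -/
structure IsSymplecticForm (Ω : Matrix N N ℝ) : Prop where
  transpose_eq : Ωᵀ = -Ω
  mul_self_eq : Ω * Ω = -1

theorem isSymplecticForm_Omg (n : ℕ) : IsSymplecticForm (Omg n) where
  transpose_eq := by simp [Omg, fromBlocks_transpose, fromBlocks_neg]
  mul_self_eq := by simp [Omg, fromBlocks_multiply, ← fromBlocks_one, fromBlocks_neg]

namespace IsSymplecticForm

theorem fromBlocks {m n : Type*} [Fintype m] [Fintype n] [DecidableEq m] [DecidableEq n]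
    {Ω₁ : Matrix m m ℝ} {Ω₂ : Matrix n n ℝ} (h₁ : IsSymplecticForm Ω₁)
    (h₂ : IsSymplecticForm Ω₂) : IsSymplecticForm (Matrix.fromBlocks Ω₁ 0 0 Ω₂) where
  transpose_eq := by
    simp [fromBlocks_transpose, fromBlocks_neg, h₁.transpose_eq, h₂.transpose_eq]
  mul_self_eq := by
    simp [fromBlocks_multiply, ← fromBlocks_one, fromBlocks_neg, h₁.mul_self_eq, h₂.mul_self_eq]

variable {Ω : Matrix N N ℝ} (hΩ : IsSymplecticForm Ω)

include hΩ

theorem isUnit : IsUnit Ω :=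
  IsUnit.of_mul_eq_one (-Ω) (by rw [mul_neg, hΩ.mul_self_eq, neg_neg])

theorem det_neg_conj (X : Matrix N N ℝ) : (-(Ω * X * Ω)).det = X.det := by
  have h1 : (-Ω * Ω).det = 1 := by rw [neg_mul, hΩ.mul_self_eq, neg_neg, det_one]
  have h2 : -(Ω * X * Ω) = -Ω * X * Ω := by simp
  rw [h2, det_mul, det_mul, mul_right_comm, ← det_mul, h1, one_mul]

/-- The geometric mean of `W` and its symplectic dual `-Ω W⁻¹ Ω` is symplectic. -/
theorem exists_geometricMean {W : Matrix N N ℝ} (hW : W.PosDef) :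
    ∃ γ : Matrix N N ℝ, γ.PosDef ∧ γ * Ω * γ = Ω ∧ γ * W⁻¹ * γ = -(Ω * W⁻¹ * Ω) := by
  obtain ⟨R, hR, hRR, -⟩ := hW.exists_sqrt
  have hu : IsUnit R.det := hR.det_pos.ne'.isUnit
  set L := R⁻¹ * Ω * R⁻¹ with hL
  have hLu : IsUnit L := (hR.inv.isUnit.mul hΩ.isUnit).mul hR.inv.isUnit
  have hLT : Lᵀ = -L := by
    have := hR.inv.isHermitian.eq
    rw [conjTranspose_eq_transpose_of_trivial] at this
    rw [hL, transpose_mul, transpose_mul, this, hΩ.transpose_eq]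
    simp [Matrix.mul_assoc]
  have hK : (-(L * L)).PosDef := by
    have := PosDef.conjTranspose_mul_self L (mulVec_injective_of_isUnit hLu)
    rwa [conjTranspose_eq_transpose_of_trivial, hLT, neg_mul] at this
  obtain ⟨H, hH, hHH, hHL⟩ := hK.exists_sqrt
  have hcomm : H * L = L * H := hHL L ((Commute.refl L).mul_left (Commute.refl L)).neg_left
  have hRLR : R * L * R = Ω := by
    simp [hL, Matrix.mul_assoc, mul_nonsing_inv_cancel_left _ _ hu, nonsing_inv_mul _ hu]
  have hHMH : H * (R * Ω * R) * H = L := by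
    have hLM : L * (R * Ω * R) = -1 := by
      have : L * (R * Ω * R) = R⁻¹ * (Ω * Ω) * R := by
        simp [hL, Matrix.mul_assoc, nonsing_inv_mul_cancel_left _ _ hu]
      rw [this, hΩ.mul_self_eq]
      simp [nonsing_inv_mul _ hu]
    refine hLu.mul_left_cancel ?_
    rw [← mul_assoc, ← mul_assoc, ← hcomm, mul_assoc H L, hLM, mul_neg, mul_one, neg_mul, hHH,
      neg_neg]
  refine ⟨R * H * R, ?_, ?_, ?_⟩
  · have := hH.conjTranspose_mul_mul_same (mulVec_injective_of_isUnit hR.isUnit)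
    rwa [hR.isHermitian.eq] at this
  · calc R * H * R * Ω * (R * H * R) = R * (H * (R * Ω * R) * H) * R := by noncomm_ring
      _ = Ω := by rw [hHMH, hRLR]
  · have hWi : W⁻¹ = R⁻¹ * R⁻¹ := by rw [← hRR, Matrix.mul_inv_rev]
    calc R * H * R * W⁻¹ * (R * H * R) = R * (H * H) * R := by
          simp [hWi, Matrix.mul_assoc, mul_nonsing_inv_cancel_left _ _ hu,
            nonsing_inv_mul_cancel_left _ _ hu]
      _ = -(Ω * W⁻¹ * Ω) := by
          rw [hHH, hWi]
          simp [hL, Matrix.mul_assoc, mul_nonsing_inv_cancel_left _ _ hu, nonsing_inv_mul _ hu]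

theorem isPureQCM_of_posDef {γ : Matrix N N ℝ} (hγ : γ.PosDef) (h : γ * Ω * γ = Ω) :
    IsPureQCM Ω γ := by
  obtain ⟨S, hS, hSS, -⟩ := hγ.exists_sqrt
  have hu : IsUnit S.det := hS.det_pos.ne'.isUnit
  have hST : Sᵀ = S := by
    simpa [conjTranspose_eq_transpose_of_trivial] using hS.isHermitian.eq
  have hX : (-(Ω * S * Ω)).PosSemidef := by
    have := hS.posSemidef.conjTranspose_mul_mul_same Ω
    rwa [conjTranspose_eq_transpose_of_trivial, hΩ.transpose_eq, neg_mul, neg_mul] at this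
  have hXS : -(Ω * S * Ω) = S⁻¹ := by
    refine hX.eq_of_mul_self_eq hS.inv.posSemidef ?_
    have h1 : -(Ω * S * Ω) * -(Ω * S * Ω) = Ω * S * (Ω * Ω) * S * Ω := by noncomm_ring
    rw [h1, hΩ.mul_self_eq, ← Matrix.mul_inv_rev, hSS]
    symm
    apply inv_eq_right_inv
    calc γ * (Ω * S * -1 * S * Ω) = -(γ * Ω * (S * S) * Ω) := by noncomm_ring
      _ = 1 := by rw [hSS, h, hΩ.mul_self_eq, neg_neg]
  refine ⟨S, ?_, by rw [hST, hSS]⟩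
  have h2 : S * -(Ω * S * Ω) = 1 := by rw [hXS, mul_nonsing_inv _ hu]
  have h3 : S * -(Ω * S * Ω) * Ω = S * Ω * S := by
    calc S * -(Ω * S * Ω) * Ω = -(S * Ω * S * (Ω * Ω)) := by noncomm_ring
      _ = S * Ω * S := by rw [hΩ.mul_self_eq]; simp
  rw [IsSymplectic, hST, ← h3, h2, one_mul]

theorem posDef_and_det_eq_one_of_isPureQCM {γ : Matrix N N ℝ} (h : IsPureQCM Ω γ) :
    γ.PosDef ∧ γ.det = 1 := by
  obtain ⟨S, hS, rfl⟩ := h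
  have hΩd : Ω.det ≠ 0 := ((isUnit_iff_isUnit_det _).1 hΩ.isUnit).ne_zero
  have hd : S.det * S.det = 1 := by
    have := congrArg det hS
    rw [det_mul, det_mul, det_transpose] at this
    exact mul_right_cancel₀ hΩd (by linear_combination this)
  refine ⟨?_, by rw [det_mul, det_transpose, hd]⟩
  have hSu : IsUnit S := (isUnit_iff_isUnit_det _).2 (IsUnit.of_mul_eq_one _ hd)
  simpa using PosDef.mul_conjTranspose_self S (vecMul_injective_of_isUnit hSu)

end IsSymplecticForm

/-- The real form of `V + iΩ ≥ 0`. -/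
theorem IsQCM.posSemidef_fromBlocks {Ω V : Matrix N N ℝ} (hΩ : Ωᵀ = -Ω) (h : IsQCM Ω V) :
    (fromBlocks V (-Ω) Ω V).PosSemidef := by
  refine .of_dotProduct_mulVec_nonneg ?_ fun w => ?_
  · rw [IsHermitian, conjTranspose_eq_transpose_of_trivial, fromBlocks_transpose, h.1.eq,
      transpose_neg, hΩ, neg_neg]
  · have hz := h.2.dotProduct_mulVec_nonneg
      fun i => (w (Sum.inl i) : ℂ) + w (Sum.inr i) * Complex.I
    have hre := (Complex.le_def.1 hz).1
    simp only [dotProduct, mulVec, Complex.zero_re, Complex.re_sum, Finset.mul_sum,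
      Fintype.sum_sum_type, ← Finset.sum_add_distrib] at hre ⊢
    refine hre.trans_eq (Finset.sum_congr rfl fun i _ => Finset.sum_congr rfl fun j _ => ?_)
    simp [cplx]
    ring

theorem IsQCM.posDef {Ω V : Matrix N N ℝ} (hΩ : IsSymplecticForm Ω) (h : IsQCM Ω V) :
    V.PosDef := by
  have hM := h.posSemidef_fromBlocks hΩ.transpose_eq
  have hV : V.PosSemidef := hM.submatrix Sum.inl
  refine .of_dotProduct_mulVec_pos hV.isHermitian fun x hx => ?_
  refine lt_of_le_of_ne (hV.dotProduct_mulVec_nonneg x) fun h0 => hx ?_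
  have h1 := (hM.dotProduct_mulVec_zero_iff (Sum.elim x 0)).1 (by
    rw [fromBlocks_mulVec]
    simpa [dotProduct, Fintype.sum_sum_type] using h0.symm)
  refine mulVec_injective_of_isUnit hΩ.isUnit ?_
  funext i
  simpa [fromBlocks_mulVec] using congrFun h1 (Sum.inr i)

end SymplecticForms

section Dual

variable {m n : Type*} [Fintype m] [Fintype n] [DecidableEq m] [DecidableEq n]

/-- The symplectic dual of the Schur complement of a QCM is bounded by its marginal. -/
theorem IsQCM.toBlocks₁₁_add_posSemidef {Ω₁ : Matrix m m ℝ} {Ω₂ : Matrix n n ℝ}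
    {V : Matrix (m ⊕ n) (m ⊕ n) ℝ} (h₁ : IsSymplecticForm Ω₁) (h₂ : IsSymplecticForm Ω₂)
    (hV : IsQCM (fromBlocks Ω₁ 0 0 Ω₂) V) :
    (V.toBlocks₁₁ + Ω₁ * (schurCompl V)⁻¹ * Ω₁).PosSemidef := by
  have hpd : V.PosDef := hV.posDef (h₁.fromBlocks h₂)
  have hW := schurCompl_posDef hpd
  have hM := hV.posSemidef_fromBlocks (h₁.fromBlocks h₂).transpose_eq
  set T := schurMap V with hT
  set E : Matrix (m ⊕ n) m ℝ := fromRows 1 0 with hE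
  have hC := hM.conjTranspose_mul_mul_same (fromBlocks T 0 0 E)
  have hΩE : fromBlocks Ω₁ 0 0 Ω₂ * E = fromRows Ω₁ 0 := by
    simp [hE, fromBlocks_mul_fromRows]
  have hTΩE : Tᵀ * (fromBlocks Ω₁ 0 0 Ω₂ * E) = Ω₁ := by
    rw [hΩE, hT, schurMap, transpose_fromRows, fromCols_mul_fromRows]
    simp
  have hEΩT : Eᵀ * (fromBlocks Ω₁ 0 0 Ω₂ * T) = Ω₁ := by
    have := congrArg transpose hTΩE
    rw [transpose_mul, transpose_mul, transpose_transpose, (h₁.fromBlocks h₂).transpose_eq,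
      h₁.transpose_eq] at this
    simpa [Matrix.mul_assoc] using this
  have hEVE : Eᵀ * (V * E) = V.toBlocks₁₁ := by
    conv_lhs => rw [← fromBlocks_toBlocks V]
    simp [hE, fromBlocks_mul_fromRows, transpose_fromRows, fromCols_mul_fromRows]
  have hTVT : Tᵀ * (V * T) = schurCompl V := by
    rw [← Matrix.mul_assoc]
    exact schurMap_transpose_mul_mul hpd
  have hblock : (fromBlocks (schurCompl V) (-Ω₁) (-Ω₁)ᴴ V.toBlocks₁₁).PosSemidef := by
    convert hC using 1
    simp [fromBlocks_transpose, fromBlocks_multiply, Matrix.mul_assoc, hTΩE, hEΩT, hEVE, hTVT,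
      h₁.transpose_eq]
  let := invertibleOfIsUnitDet _ hW.det_pos.ne'.isUnit
  have := (PosDef.fromBlocks₁₁ _ _ hW).1 hblock
  simpa [h₁.transpose_eq] using this

theorem posSemidef_fromBlocks_of_mul_inv_mul {W γ : Matrix m m ℝ} (hW : W.PosDef)
    (hγ : γ.IsHermitian) : (fromBlocks W γ γ (γ * W⁻¹ * γ)).PosSemidef := by
  let := invertibleOfIsUnitDet _ hW.det_pos.ne'.isUnit
  have := (PosDef.fromBlocks₁₁ γ (γ * W⁻¹ * γ) hW).2 (by
    rw [hγ.eq, sub_self]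
    exact .zero)
  rwa [hγ.eq] at this

theorem posSemidef_add_sub_of_fromBlocks {X Y γ : Matrix m m ℝ}
    (h : (fromBlocks X γ γ Y).PosSemidef) : (X + Y - γ - γ).PosSemidef := by
  have := h.conjTranspose_mul_mul_same (fromRows (1 : Matrix m m ℝ) (-1))
  rw [Matrix.mul_assoc, fromBlocks_mul_fromRows, conjTranspose_fromRows_eq_fromCols_conjTranspose,
    fromCols_mul_fromRows] at this
  convert this using 1
  simp
  abel

end Dual

section Tripartite

variable {α β ν : Type*} [Fintype α] [Fintype β] [Fintype ν] [DecidableEq α] [DecidableEq β]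
  [DecidableEq ν]

theorem IsQCM.submatrix_equiv {N M : Type*} [Fintype N] [DecidableEq N] [Fintype M]
    [DecidableEq M] {Ω V : Matrix N N ℝ} (h : IsQCM Ω V) (e : M ≃ N) :
    IsQCM (Ω.submatrix e e) (V.submatrix e e) :=
  ⟨h.1.submatrix e, h.2.submatrix e⟩

/-- The bound on determinants behind the bound of the entanglement of formation by the
conditional mutual information. -/
theorem exists_pure_le_of_isQCM {Ωa : Matrix α α ℝ} {Ωb : Matrix β β ℝ} {Ωc : Matrix ν ν ℝ}
    (ha : IsSymplecticForm Ωa) (hb : IsSymplecticForm Ωb) (hc : IsSymplecticForm Ωc)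
    {V : Matrix ((α ⊕ β) ⊕ ν) ((α ⊕ β) ⊕ ν) ℝ}
    (hV : IsQCM (fromBlocks (fromBlocks Ωa 0 0 Ωb) 0 0 Ωc) V) :
    ∃ γ : Matrix (α ⊕ β) (α ⊕ β) ℝ, IsPureQCM (fromBlocks Ωa 0 0 Ωb) γ ∧
      (V.toBlocks₁₁ - γ).PosSemidef ∧
      γ.toBlocks₁₁.det * γ.toBlocks₂₂.det ≤
        (schurCompl V).toBlocks₁₁.det * (schurCompl V).toBlocks₂₂.det / (schurCompl V).det := by
  have hΩ := ha.fromBlocks hb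
  have hpd : V.PosDef := hV.posDef (hΩ.fromBlocks hc)
  have hWV := toBlocks₁₁_sub_schurCompl_posSemidef hpd
  have hdual := hV.toBlocks₁₁_add_posSemidef hΩ hc
  have hW := schurCompl_posDef hpd
  set W := schurCompl V
  set Ω := fromBlocks Ωa 0 0 Ωb with hΩdef
  obtain ⟨γ, hγ, hγΩ, hγW⟩ := hΩ.exists_geometricMean hW
  have hblock := posSemidef_fromBlocks_of_mul_inv_mul hW hγ.isHermitian
  rw [hγW] at hblock
  refine ⟨γ, hΩ.isPureQCM_of_posDef hγ hγΩ, ?_, ?_⟩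
  · have h1 := (hWV.add hdual).add (posSemidef_add_sub_of_fromBlocks hblock)
    have h2 := h1.smul (show (0 : ℝ) ≤ 1 / 2 by norm_num)
    convert h2 using 1
    module
  · have hA : γ.toBlocks₁₁.det ^ 2 ≤
        W.toBlocks₁₁.det * (-(Ω * W⁻¹ * Ω)).toBlocks₁₁.det :=
      det_sq_le_of_posSemidef_fromBlocks hW.toBlocks₁₁ hγ.toBlocks₁₁ (by
        convert hblock.submatrix (Sum.map Sum.inl Sum.inl) using 1
        ext (i | i) (j | j) <;> rfl)
    have hB : γ.toBlocks₂₂.det ^ 2 ≤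
        W.toBlocks₂₂.det * (-(Ω * W⁻¹ * Ω)).toBlocks₂₂.det :=
      det_sq_le_of_posSemidef_fromBlocks hW.toBlocks₂₂ hγ.toBlocks₂₂ (by
        convert hblock.submatrix (Sum.map Sum.inr Sum.inr) using 1
        ext (i | i) (j | j) <;> rfl)
    have hconj : -(Ω * W⁻¹ * Ω) = fromBlocks (-(Ωa * W⁻¹.toBlocks₁₁ * Ωa))
        (-(Ωa * W⁻¹.toBlocks₁₂ * Ωb)) (-(Ωb * W⁻¹.toBlocks₂₁ * Ωa))
        (-(Ωb * W⁻¹.toBlocks₂₂ * Ωb)) := by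
      conv_lhs => rw [← fromBlocks_toBlocks W⁻¹, hΩdef]
      simp [fromBlocks_multiply, fromBlocks_neg]
    rw [hconj, toBlocks_fromBlocks₁₁, ha.det_neg_conj] at hA
    rw [hconj, toBlocks_fromBlocks₂₂, hb.det_neg_conj] at hB
    have hdW := hW.det_pos
    have hA' : W⁻¹.toBlocks₁₁.det = W.toBlocks₂₂.det / W.det := by
      rw [eq_div_iff hdW.ne', mul_comm, det_mul_det_inv_toBlocks₁₁ hW]
    have hB' : W⁻¹.toBlocks₂₂.det = W.toBlocks₁₁.det / W.det := by
      rw [eq_div_iff hdW.ne', mul_comm, det_mul_det_inv_toBlocks₂₂ hW]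
    rw [hA', ← mul_div_assoc] at hA
    rw [hB', ← mul_div_assoc, mul_comm W.toBlocks₂₂.det] at hB
    have hr : 0 ≤ W.toBlocks₁₁.det * W.toBlocks₂₂.det / W.det :=
      div_nonneg (mul_nonneg hW.toBlocks₁₁.det_pos.le hW.toBlocks₂₂.det_pos.le) hdW.le
    refine (le_abs_self _).trans (abs_le_of_sq_le_sq ?_ hr)
    rw [mul_pow, sq (_ / _)]
    exact mul_le_mul hA hB (sq_nonneg _) hr

/-- The conditional mutual information is the mutual information of the Schur complement. -/
theorem IM3_eq_IM2_schurCompl {V : Matrix (α ⊕ (β ⊕ ν)) (α ⊕ (β ⊕ ν)) ℝ} (hV : V.PosDef) :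
    IM3 V = IM2 (schurCompl
      (V.submatrix (Equiv.sumAssoc α β ν) (Equiv.sumAssoc α β ν))) := by
  have hV' := hV.submatrix (Equiv.sumAssoc α β ν).injective
  have hAC : (V.submatrix (eAC : α ⊕ ν → α ⊕ (β ⊕ ν)) eAC).PosDef :=
    hV.submatrix (Sum.map_injective.2 ⟨Function.injective_id, Sum.inr_injective⟩)
  have hBC : (V.submatrix (eBC : β ⊕ ν → α ⊕ (β ⊕ ν)) eBC).PosDef :=
    hV.submatrix Sum.inr_injective
  have h1 := det_eq_mul_det_schurCompl hV'.toBlocks₂₂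
  have h2 := det_eq_mul_det_schurCompl hAC.toBlocks₂₂
  have h3 := det_eq_mul_det_schurCompl hBC.toBlocks₂₂
  have hC : 0 < (V.submatrix (eC : ν → α ⊕ (β ⊕ ν)) eC).det :=
    (hV.submatrix (e := eC) (Sum.inr_injective.comp Sum.inr_injective)).det_pos
  rw [det_submatrix_equiv_self] at h1
  rw [IM3, IM2, h1, h2, h3]
  change _ = 1 / 2 * Real.log ((schurCompl (V.submatrix eAC eAC)).det *
    (schurCompl (V.submatrix eBC eBC)).det / _)
  change 1 / 2 * Real.log ((V.submatrix eC eC).det * _ * ((V.submatrix eC eC).det * _) /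
    ((V.submatrix eC eC).det * ((V.submatrix eC eC).det * _))) = _
  congr 2
  field_simp

theorem IM2_nonneg {V : Matrix (α ⊕ β) (α ⊕ β) ℝ} (hV : V.PosDef) : 0 ≤ IM2 V := by
  refine mul_nonneg (by norm_num) (Real.log_nonneg ?_)
  rw [one_le_div hV.det_pos]
  exact hV.det_le_mul_det_toBlocks

end Tripartite

/-- for every tripartite QCM `V_ABC`,
`(1/2)·I_M(A:B|C)_V ≥ E^G_{F,2}(A:B)_{V_AB}`; equivalently, there is a pure QCM
`γ_AB ≤ V_AB` with `I_M(A:B)_γ ≤ I_M(A:B|C)_V`. -/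
theorem stmt16 {nA nB nC : ℕ}
    (V : Matrix ((Fin nA ⊕ Fin nA) ⊕ ((Fin nB ⊕ Fin nB) ⊕ (Fin nC ⊕ Fin nC)))
      ((Fin nA ⊕ Fin nA) ⊕ ((Fin nB ⊕ Fin nB) ⊕ (Fin nC ⊕ Fin nC))) ℝ)
    (hV : IsQCM (fromBlocks (Omg nA) 0 0 (fromBlocks (Omg nB) 0 0 (Omg nC))) V) :
    (1 / 2) * IM3 V ≥ EF2 (fromBlocks (Omg nA) 0 0 (Omg nB)) (V.submatrix eAB eAB) ∧
      ∃ γ : Matrix ((Fin nA ⊕ Fin nA) ⊕ (Fin nB ⊕ Fin nB))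
          ((Fin nA ⊕ Fin nA) ⊕ (Fin nB ⊕ Fin nB)) ℝ,
        IsPureQCM (fromBlocks (Omg nA) 0 0 (Omg nB)) γ ∧
          (V.submatrix eAB eAB - γ).PosSemidef ∧ IM2 γ ≤ IM3 V := by
  set Ω := fromBlocks (Omg nA) 0 0 (fromBlocks (Omg nB) 0 0 (Omg nC)) with hΩ
  have ha := isSymplecticForm_Omg nA
  have hb := isSymplecticForm_Omg nB
  have hc := isSymplecticForm_Omg nC
  have hpd : V.PosDef := hV.posDef (ha.fromBlocks (hb.fromBlocks hc))
  set e := Equiv.sumAssoc (Fin nA ⊕ Fin nA) (Fin nB ⊕ Fin nB) (Fin nC ⊕ Fin nC)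
  have hΩe : Ω.submatrix e e =
      fromBlocks (fromBlocks (Omg nA) 0 0 (Omg nB)) 0 0 (Omg nC) := by
    ext ((i | i) | i) ((j | j) | j) <;> rfl
  have hV' := hV.submatrix_equiv e
  rw [hΩe] at hV'
  have hAB : V.submatrix eAB eAB = (V.submatrix e e).toBlocks₁₁ := by
    ext (i | i) (j | j) <;> rfl
  obtain ⟨γ, hγ, hle, hdet⟩ := exists_pure_le_of_isQCM ha hb hc hV'
  rw [← hAB] at hle
  have hbound : IM2 γ ≤ IM3 V := by
    obtain ⟨hγpd, hγdet⟩ := (ha.fromBlocks hb).posDef_and_det_eq_one_of_isPureQCM hγ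
    rw [IM3_eq_IM2_schurCompl hpd, IM2, IM2, hγdet, div_one]
    gcongr
    exact mul_pos hγpd.toBlocks₁₁.det_pos hγpd.toBlocks₂₂.det_pos
  refine ⟨?_, γ, hγ, hle, hbound⟩
  have hEF : EF2 (fromBlocks (Omg nA) 0 0 (Omg nB)) (V.submatrix eAB eAB) ≤ (1 / 2) * IM2 γ := by
    refine csInf_le ⟨0, ?_⟩ ⟨γ, hγ, hle, rfl⟩
    rintro x ⟨δ, hδ, -, rfl⟩
    exact mul_nonneg (by norm_num)
      (IM2_nonneg ((ha.fromBlocks hb).posDef_and_det_eq_one_of_isPureQCM hδ).1)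
  exact hEF.trans (mul_le_mul_of_nonneg_left hbound (by norm_num))
end
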